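/- Let Ω be the unit disc with three closed discs removed: Ω = D(0,1) \ ( cl(D(1/2, 1/10)) ∪ cl(D(i/2, 1/20)) ∪ cl(D(−1/2, 1/30)) ). Then Ω is rigid: the only automorphism of Ω is the identity map. -/

import Mathlib

/-- The unit disc with the closed discs `cl(D(1/2, 1/10))`, `cl(D(i/2, 1/20))`,
`cl(D(-1/2, 1/30))` removed. -/
def RigidDomain : Set ℂ :=
  Metric.ball (0:ℂ) 1 \
    (Metric.closedBall ((1:ℂ)/2) (1/10) ∪
     Metric.closedBall (Complex.I/2) (1/20) ∪
     Metric.closedBall (-(1:ℂ)/2) (1/30))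

open Metric Set Filter Topology Real
open scoped ComplexConjugate

theorem hasDerivAt_cauchyTransform {h : ℂ → ℂ} {c : ℂ} {ρ : ℝ} (hρ : 0 ≤ ρ)
    (hh : ContinuousOn h (sphere c ρ)) {z₀ : ℂ} (hz₀ : z₀ ∉ sphere c ρ) :
    HasDerivAt (fun z => ∮ ζ in C(c, ρ), h ζ / (ζ - z)) (∮ ζ in C(c, ρ), h ζ / (ζ - z₀) ^ 2) z₀ := by
  obtain ⟨M, hM⟩ := (isCompact_sphere c ρ).exists_bound_of_continuousOn hh
  obtain ⟨d, hd, hdist⟩ := Metric.isOpen_iff.1 (isClosed_sphere (x := c) (ε := ρ)).isOpen_compl z₀ hz₀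
  have hcm : ∀ θ, circleMap c ρ θ ∈ sphere c ρ := fun θ => circleMap_mem_sphere c hρ θ
  have hcont : Continuous fun θ => h (circleMap c ρ θ) :=
    hh.comp_continuous (continuous_circleMap c ρ) hcm
  have hne : ∀ z ∈ ball z₀ (d / 2), ∀ θ, d / 2 ≤ ‖circleMap c ρ θ - z‖ := by
    intro z hz θ
    by_contra! hlt
    have : circleMap c ρ θ ∈ ball z₀ d := by
      rw [mem_ball] at hz ⊢
      rw [← dist_eq_norm] at hlt
      linarith [dist_triangle (circleMap c ρ θ) z z₀]
    exact hdist this (hcm θ)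
  have hne0 : ∀ z ∈ ball z₀ (d / 2), ∀ θ, circleMap c ρ θ - z ≠ 0 := fun z hz θ =>
    norm_pos_iff.1 (by linarith [hne z hz θ])
  have hz₀' : z₀ ∈ ball z₀ (d / 2) := mem_ball_self (by linarith)
  have hF : ∀ z ∈ ball z₀ (d / 2), Continuous fun θ =>
      deriv (circleMap c ρ) θ • (h (circleMap c ρ θ) / (circleMap c ρ θ - z)) := by
    intro z hz
    simp only [deriv_circleMap]
    refine Continuous.smul (by fun_prop : Continuous fun θ => circleMap 0 ρ θ * Complex.I) (hcont.div (by fun_prop) (hne0 z hz))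
  have hF' : Continuous fun θ =>
      deriv (circleMap c ρ) θ • (h (circleMap c ρ θ) / (circleMap c ρ θ - z₀) ^ 2) := by
    simp only [deriv_circleMap]
    refine Continuous.smul (by fun_prop : Continuous fun θ => circleMap 0 ρ θ * Complex.I)
      (hcont.div (by fun_prop) fun θ => pow_ne_zero 2 (hne0 z₀ hz₀' θ))
  refine (intervalIntegral.hasDerivAt_integral_of_dominated_loc_of_deriv_le
    (F := fun z θ => deriv (circleMap c ρ) θ • (h (circleMap c ρ θ) / (circleMap c ρ θ - z)))
    (F' := fun z θ => deriv (circleMap c ρ) θ • (h (circleMap c ρ θ) / (circleMap c ρ θ - z) ^ 2))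
    (bound := fun _ => |ρ| * (M / (d / 2) ^ 2)) (ball_mem_nhds z₀ (half_pos hd))
    ?_ ?_ ?_ ?_ ?_ ?_).2
  · filter_upwards [ball_mem_nhds z₀ (half_pos hd)] with z hz
    exact (hF z hz).aestronglyMeasurable
  · exact (hF z₀ hz₀').intervalIntegrable _ _
  · exact hF'.aestronglyMeasurable
  · refine Eventually.of_forall fun θ _ z hz => ?_
    rw [norm_smul, deriv_circleMap, norm_mul, norm_circleMap_zero, Complex.norm_I, mul_one,
      norm_div, norm_pow]
    have := hM _ (hcm θ)
    have h0 : 0 ≤ M := (norm_nonneg _).trans this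
    gcongr
    exact hne z hz θ
  · exact intervalIntegrable_const
  · refine Eventually.of_forall fun θ _ z hz => ?_
    have h1 : HasDerivAt (fun z => circleMap c ρ θ - z) (-1) z := by
      simpa using (hasDerivAt_id z).const_sub (circleMap c ρ θ)
    have := ((h1.inv (hne0 z hz θ)).const_mul (h (circleMap c ρ θ))).const_smul
      (deriv (circleMap c ρ) θ)
    refine (this.congr_deriv ?_).congr_of_eventuallyEq (.of_forall fun w => ?_)
    · simp [div_eq_mul_inv]
    · simp [div_eq_mul_inv]

theorem tendsto_mul_cauchyTransform {h : ℂ → ℂ} {c : ℂ} {ρ : ℝ} (hρ : 0 ≤ ρ)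
    (hh : ContinuousOn h (sphere c ρ)) :
    Tendsto (fun z => z * ∮ ζ in C(c, ρ), h ζ / (ζ - z)) (Bornology.cobounded ℂ)
      (𝓝 (-∮ ζ in C(c, ρ), h ζ)) := by
  obtain ⟨M, hM⟩ := (isCompact_sphere c ρ).exists_bound_of_continuousOn hh
  set A := ‖c‖ + ρ
  have hA : ∀ ζ ∈ sphere c ρ, ‖ζ‖ ≤ A := fun ζ hζ => by
    have := norm_add_le c (ζ - c)
    rw [mem_sphere_iff_norm] at hζ
    simpa [A, hζ] using this
  have hA0 : 0 ≤ A := by positivity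
  rw [tendsto_iff_norm_sub_tendsto_zero]
  have hlim : Tendsto (fun z : ℂ => 2 * π * ρ * (M * A) * (‖z‖ - A)⁻¹) (Bornology.cobounded ℂ)
      (𝓝 0) := by
    have : Tendsto (fun z : ℂ => ‖z‖ + -A) (Bornology.cobounded ℂ) atTop :=
      tendsto_atTop_add_const_right _ _ tendsto_norm_cobounded_atTop
    simpa [sub_eq_add_neg] using (tendsto_inv_atTop_zero.comp this).const_mul (2 * π * ρ * (M * A))
  refine squeeze_zero' (Eventually.of_forall fun _ => norm_nonneg _) ?_ hlim
  filter_upwards [(tendsto_norm_cobounded_atTop (E := ℂ)).eventually_gt_atTop A] with z hz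
  have hne : ∀ ζ ∈ sphere c ρ, ‖z‖ - A ≤ ‖ζ - z‖ := fun ζ hζ => by
    have := norm_sub_norm_le z ζ
    rw [norm_sub_rev] at this
    linarith [hA ζ hζ]
  have hne0 : ∀ ζ ∈ sphere c ρ, ζ - z ≠ 0 := fun ζ hζ =>
    norm_pos_iff.1 (by linarith [hne ζ hζ])
  have hi : CircleIntegrable (fun ζ => z * (h ζ / (ζ - z))) c ρ :=
    (continuousOn_const.mul (hh.div (by fun_prop) hne0)).circleIntegrable hρ
  rw [sub_neg_eq_add, ← circleIntegral.integral_const_mul,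
    ← circleIntegral.integral_add hi (hh.circleIntegrable hρ), mul_assoc]
  refine circleIntegral.norm_integral_le_of_norm_le_const hρ fun ζ hζ => ?_
  have : z * (h ζ / (ζ - z)) + h ζ = h ζ * ζ / (ζ - z) := by
    field_simp [hne0 ζ hζ]; ring
  rw [this, norm_div, norm_mul, div_eq_mul_inv]
  have h1 := hM ζ hζ
  have h2 := (norm_nonneg _).trans h1
  have h3 : 0 < ‖z‖ - A := by linarith
  gcongr
  · exact hA ζ hζ
  · exact hne ζ hζ

theorem circleIntegral_eq_of_annulus {h : ℂ → ℂ} {c : ℂ} {r ρ₁ ρ₂ R : ℝ} (hr : 0 ≤ r)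
    (h1 : r < ρ₁) (h12 : ρ₁ ≤ ρ₂) (h2 : ρ₂ < R)
    (hh : DifferentiableOn ℂ h (ball c R \ closedBall c r)) :
    (∮ ζ in C(c, ρ₂), h ζ) = ∮ ζ in C(c, ρ₁), h ζ := by
  have hsub : closedBall c ρ₂ \ ball c ρ₁ ⊆ ball c R \ closedBall c r := fun z hz =>
    ⟨closedBall_subset_ball h2 hz.1, fun hz' => hz.2 (closedBall_subset_ball h1 hz')⟩
  refine Complex.circleIntegral_eq_of_differentiable_on_annulus_off_countable (hr.trans_lt h1) h12
    countable_empty (hh.continuousOn.mono hsub) fun z hz => ?_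
  refine hh.differentiableAt ((isOpen_ball.sdiff isClosed_closedBall).mem_nhds (hsub ?_))
  exact ⟨ball_subset_closedBall hz.1.1, fun hz' => hz.1.2 (ball_subset_closedBall hz')⟩

theorem cauchy_formula_annulus {h : ℂ → ℂ} {c : ℂ} {r ρ₁ ρ₂ R : ℝ} (hr : 0 ≤ r)
    (h1 : r < ρ₁) (h2 : ρ₂ < R)
    (hh : DifferentiableOn ℂ h (ball c R \ closedBall c r)) {z : ℂ} (hz1 : z ∉ closedBall c ρ₁)
    (hz2 : z ∈ ball c ρ₂) :
    (∮ ζ in C(c, ρ₂), h ζ / (ζ - z)) =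
      (∮ ζ in C(c, ρ₁), h ζ / (ζ - z)) + 2 * π * Complex.I * h z := by
  have hz1' : ρ₁ < ‖z - c‖ := by simpa [dist_eq_norm] using hz1
  have hz2' : ‖z - c‖ < ρ₂ := by simpa [dist_eq_norm] using hz2
  have h12 : ρ₁ ≤ ρ₂ := by linarith
  have hopen : IsOpen (ball c R \ closedBall c r) := isOpen_ball.sdiff isClosed_closedBall
  have hzmem : z ∈ ball c R \ closedBall c r := by
    simp only [Set.mem_sdiff, mem_ball, mem_closedBall, dist_eq_norm]
    constructor <;> linarith
  have hk : DifferentiableOn ℂ (dslope h z) (ball c R \ closedBall c r) :=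
    (Complex.differentiableOn_dslope (hopen.mem_nhds hzmem)).2 hh
  have key := circleIntegral_eq_of_annulus hr h1 h12 h2 hk
  have hsplit : ∀ ρ, 0 ≤ ρ → r < ρ → ρ < R → ρ ≠ ‖z - c‖ →
      (∮ ζ in C(c, ρ), dslope h z ζ) =
        (∮ ζ in C(c, ρ), h ζ / (ζ - z)) - h z * ∮ ζ in C(c, ρ), (ζ - z)⁻¹ := by
    intro ρ hρ hrρ hρR hρz
    have hne : ∀ ζ ∈ sphere c ρ, ζ - z ≠ 0 := fun ζ hζ h0 => by
      rw [mem_sphere_iff_norm] at hζ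
      rw [sub_eq_zero.1 h0] at hζ
      exact hρz hζ.symm
    have hcont : ContinuousOn h (sphere c ρ) := hh.continuousOn.mono fun ζ hζ => by
      rw [mem_sphere_iff_norm] at hζ
      simp only [Set.mem_sdiff, mem_ball, mem_closedBall, dist_eq_norm]
      constructor <;> linarith
    have hci : ContinuousOn (fun ζ => (ζ - z)⁻¹) (sphere c ρ) :=
      ContinuousOn.inv₀ (by fun_prop) hne
    have hi1 : CircleIntegrable (fun ζ => h ζ / (ζ - z)) c ρ :=
      (hcont.div (by fun_prop) hne).circleIntegrable hρ
    have hi2 : CircleIntegrable (fun ζ => h z * (ζ - z)⁻¹) c ρ :=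
      (continuousOn_const.mul hci).circleIntegrable hρ
    rw [← circleIntegral.integral_const_mul, ← circleIntegral.integral_sub hi1 hi2]
    refine circleIntegral.integral_congr hρ fun ζ hζ => ?_
    rw [dslope_of_ne _ (sub_ne_zero.1 (hne ζ hζ)), slope_def_field]
    field_simp
  rw [hsplit ρ₁ (by linarith) h1 (by linarith) (by linarith),
    hsplit ρ₂ (by linarith) (by linarith) h2 (by linarith),
    circleIntegral.integral_sub_inv_of_mem_ball hz2] at key
  have h0 : (∮ ζ in C(c, ρ₁), (ζ - z)⁻¹) = 0 := by
    refine Complex.circleIntegral_eq_zero_of_differentiable_on_off_countable (by linarith)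
      countable_empty (ContinuousOn.inv₀ (by fun_prop) ?_) ?_
    · intro ζ hζ h0
      exact hz1 (by rwa [← sub_eq_zero.1 h0])
    · intro ζ hζ
      refine DifferentiableAt.inv (by fun_prop) fun h0 => hz1 ?_
      rw [← sub_eq_zero.1 h0]
      exact ball_subset_closedBall hζ.1
  rw [h0] at key
  linear_combination key

/-- Removing the principal part of `h` at a round hole makes `h` extend across the hole. -/
theorem exists_extension_across_hole {U : Set ℂ} (hU : IsOpen U) {h : ℂ → ℂ} {c : ℂ} {r ρ R : ℝ}
    (hr : 0 ≤ r) (hrρ : r < ρ) (hρR : ρ < R) (hRU : ball c R ⊆ U)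
    (hh : DifferentiableOn ℂ h (U \ closedBall c r)) :
    ∃ H : ℂ → ℂ, DifferentiableOn ℂ H U ∧ ∀ z ∉ closedBall c ρ,
      H z = h z + (2 * π * Complex.I)⁻¹ * ∮ ζ in C(c, ρ), h ζ / (ζ - z) := by
  have hI : (2 * π * Complex.I : ℂ) ≠ 0 := Complex.two_pi_I_ne_zero
  set s := (ρ + R) / 2 with hs
  have hh' : DifferentiableOn ℂ h (ball c R \ closedBall c r) :=
    hh.mono (sdiff_subset_sdiff_left hRU)
  have hcont : ∀ t, r < t → t < R → ContinuousOn h (sphere c t) := fun t h1 h2 =>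
    hh'.continuousOn.mono fun ζ hζ => by
      rw [mem_sphere_iff_norm] at hζ
      simp only [Set.mem_sdiff, mem_ball, mem_closedBall, dist_eq_norm]
      constructor <;> linarith
  set G : ℂ → ℂ := fun z => h z + (2 * π * Complex.I)⁻¹ * ∮ ζ in C(c, ρ), h ζ / (ζ - z) with hG
  set B : ℂ → ℂ := fun z => (2 * π * Complex.I)⁻¹ * ∮ ζ in C(c, s), h ζ / (ζ - z) with hB
  have hagree : ∀ z ∈ ball c s, z ∉ closedBall c ρ → G z = B z := by
    intro z hz1 hz2
    have := cauchy_formula_annulus hr hrρ (by linarith : s < R) hh' hz2 hz1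
    simp only [hG, hB, this]
    field_simp
    ring
  classical
  refine ⟨fun z => if z ∈ closedBall c ρ then B z else G z, fun z hz => ?_, fun z hz => if_neg hz⟩
  refine DifferentiableAt.differentiableWithinAt ?_
  by_cases hzρ : z ∈ closedBall c ρ
  · have hzs : z ∈ ball c s := closedBall_subset_ball (by linarith) hzρ
    have hBd : DifferentiableAt ℂ B z :=
      (hasDerivAt_cauchyTransform (by linarith) (hcont s (by linarith) (by linarith))
        (fun hzs' => (ne_of_lt (mem_ball.1 hzs)) (mem_sphere.1 hzs'))).differentiableAt.const_mul _
    refine hBd.congr_of_eventuallyEq ?_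
    filter_upwards [isOpen_ball.mem_nhds hzs] with w hw
    by_cases hwρ : w ∈ closedBall c ρ
    · simp [hwρ]
    · simp only [hwρ, if_false]
      exact hagree w hw hwρ
  · have hGd : DifferentiableAt ℂ G z := by
      refine DifferentiableAt.add ?_ ?_
      · exact hh.differentiableAt ((hU.sdiff isClosed_closedBall).mem_nhds
          ⟨hz, fun hz' => hzρ (closedBall_subset_closedBall hrρ.le hz')⟩)
      · exact (hasDerivAt_cauchyTransform (by linarith) (hcont ρ hrρ hρR)
          (fun hz' => hzρ (sphere_subset_closedBall hz'))).differentiableAt.const_mul _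
    refine hGd.congr_of_eventuallyEq ?_
    filter_upwards [isClosed_closedBall.isOpen_compl.mem_nhds hzρ] with w hw
    exact if_neg hw

/-- The residue theorem for the complement of finitely many round holes. -/
theorem sum_circleIntegral_of_holes {ι : Type*} [DecidableEq ι] (c : ι → ℂ) (r ρ R : ι → ℝ)
    (hr : ∀ i, 0 ≤ r i) (hrρ : ∀ i, r i < ρ i) (hρR : ∀ i, ρ i < R i)
    (hdisj : ∀ i j, i ≠ j → Disjoint (ball (c i) (R i)) (ball (c j) (R j)))
    (s : Finset ι) : ∀ (h : ℂ → ℂ) (α : ℂ),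
    DifferentiableOn ℂ h (⋃ i ∈ s, closedBall (c i) (r i))ᶜ →
    Tendsto (fun z => z * h z) (Bornology.cobounded ℂ) (𝓝 α) →
    ∑ i ∈ s, ∮ ζ in C(c i, ρ i), h ζ = 2 * π * Complex.I * α := by
  have hI : (2 * π * Complex.I : ℂ) ≠ 0 := Complex.two_pi_I_ne_zero
  induction s using Finset.induction_on with
  | empty =>
    intro h α hh hα
    have hd : Differentiable ℂ h := by simpa [differentiableOn_univ] using hh
    have hlim : Tendsto h (cocompact ℂ) (𝓝 0) := by
      rw [← Metric.cobounded_eq_cocompact]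
      have h1 : Tendsto (fun z : ℂ => z⁻¹ * (z * h z)) (Bornology.cobounded ℂ) (𝓝 (0 * α)) :=
        tendsto_inv₀_cobounded.mul hα
      rw [zero_mul] at h1
      refine h1.congr' ?_
      filter_upwards [Bornology.eventually_ne_cobounded (0 : ℂ)] with z hz
      field_simp
    have h0 : h = fun _ => 0 := hd.eq_const_of_tendsto_cocompact hlim
    have : α = 0 := by
      refine tendsto_nhds_unique hα ?_
      simp [h0]
    simp [this]
  | insert a s ha ih =>
    intro h α hh hα
    set U := (⋃ i ∈ s, closedBall (c i) (r i))ᶜ with hUdef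
    have hUo : IsOpen U := by
      rw [hUdef, isOpen_compl_iff]
      exact s.finite_toSet.isClosed_biUnion fun i _ => isClosed_closedBall
    have hUeq : (⋃ i ∈ insert a s, closedBall (c i) (r i))ᶜ = U \ closedBall (c a) (r a) := by
      rw [Finset.set_biUnion_insert, compl_union, inter_comm, sdiff_eq]
    rw [hUeq] at hh
    have hRU : ball (c a) (R a) ⊆ U := by
      intro z hz hz'
      simp only [mem_iUnion] at hz'
      obtain ⟨i, hi, hzi⟩ := hz'
      refine (hdisj a i (by rintro rfl; exact ha hi)).notMem_of_mem_left hz ?_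
      exact closedBall_subset_ball ((hrρ i).trans (hρR i)) hzi
    obtain ⟨H, hHd, hH⟩ := exists_extension_across_hole hUo (hr a) (hrρ a) (hρR a) hRU hh
    have hcont : ContinuousOn h (sphere (c a) (ρ a)) := hh.continuousOn.mono fun ζ hζ => by
      refine ⟨hRU (sphere_subset_closedBall.trans (closedBall_subset_ball (hρR a)) hζ), ?_⟩
      rw [mem_closedBall, mem_sphere.1 hζ]
      exact not_le.2 (hrρ a)
    have hρ0 : ∀ i, 0 ≤ ρ i := fun i => (hr i).trans (hrρ i).le
    have hHlim : Tendsto (fun z => z * H z) (Bornology.cobounded ℂ)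
        (𝓝 (α - (2 * π * Complex.I)⁻¹ * ∮ ζ in C(c a, ρ a), h ζ)) := by
      have := hα.add ((tendsto_mul_cauchyTransform (hρ0 a) hcont).const_mul
        ((2 * π * Complex.I : ℂ)⁻¹))
      rw [mul_neg, ← sub_eq_add_neg] at this
      refine this.congr' ?_
      have hb : (closedBall (c a) (ρ a))ᶜ ∈ Bornology.cobounded ℂ :=
        Bornology.isBounded_def.1 isBounded_closedBall
      filter_upwards [hb] with z hz
      rw [hH z hz]
      ring
    have hI2 := ih H _ hHd hHlim
    have heq : ∀ i ∈ s, (∮ ζ in C(c i, ρ i), H ζ) = ∮ ζ in C(c i, ρ i), h ζ := by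
      intro i hi
      have hia : i ≠ a := by rintro rfl; exact ha hi
      have hout : ∀ z ∈ closedBall (c i) (ρ i), z ∉ closedBall (c a) (ρ a) := fun z hz hz' =>
        (hdisj i a hia).notMem_of_mem_left (closedBall_subset_ball (hρR i) hz)
          (closedBall_subset_ball (hρR a) hz')
      set P : ℂ → ℂ := fun z => (2 * π * Complex.I)⁻¹ * ∮ ζ in C(c a, ρ a), h ζ / (ζ - z)
      have hP : ∀ z ∈ closedBall (c i) (ρ i), DifferentiableAt ℂ P z := fun z hz =>
        (hasDerivAt_cauchyTransform (hρ0 a) hcont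
          (fun hz' => hout z hz (sphere_subset_closedBall hz'))).differentiableAt.const_mul _
      have hPc : ContinuousOn P (closedBall (c i) (ρ i)) := fun z hz =>
        (hP z hz).continuousAt.continuousWithinAt
      have hP0 : (∮ ζ in C(c i, ρ i), P ζ) = 0 :=
        Complex.circleIntegral_eq_zero_of_differentiable_on_off_countable (hρ0 i)
          countable_empty hPc fun z hz => hP z (ball_subset_closedBall hz.1)
      have hsub : sphere (c i) (ρ i) ⊆ U \ closedBall (c a) (r a) := by
        intro z hz
        refine ⟨?_, fun hz' => hout z (sphere_subset_closedBall hz)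
          (closedBall_subset_closedBall (hrρ a).le hz')⟩
        simp only [hUdef, mem_compl_iff, mem_iUnion, not_exists]
        intro j hj hzj
        by_cases hij : j = i
        · subst hij
          rw [mem_closedBall, mem_sphere.1 hz] at hzj
          exact not_le.2 (hrρ j) hzj
        · exact (hdisj i j (Ne.symm hij)).notMem_of_mem_left
            (closedBall_subset_ball (hρR i) (sphere_subset_closedBall hz))
            (closedBall_subset_ball ((hrρ j).trans (hρR j)) hzj)
      have hcongr : EqOn H (fun z => h z + P z) (sphere (c i) (ρ i)) := fun z hz =>
        hH z (hout z (sphere_subset_closedBall hz))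
      rw [circleIntegral.integral_congr (hρ0 i) hcongr, circleIntegral.integral_add
        ((hh.continuousOn.mono hsub).circleIntegrable (hρ0 i))
        ((hPc.mono sphere_subset_closedBall).circleIntegrable (hρ0 i)), hP0, add_zero]
    rw [Finset.sum_congr rfl heq] at hI2
    rw [Finset.sum_insert ha, hI2]
    field_simp
    ring

/-- Reflection in the circle of centre `c` and radius `r`. -/
noncomputable def circleReflection (c : ℂ) (r : ℝ) (w : ℂ) : ℂ :=
  c + (r : ℂ) ^ 2 / conj (w - c)

theorem norm_circleReflection_sub (c : ℂ) (r : ℝ) (w : ℂ) :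
    ‖circleReflection c r w - c‖ = r ^ 2 / ‖w - c‖ := by
  rw [circleReflection, add_sub_cancel_left, norm_div, Complex.norm_conj, norm_pow,
    Complex.norm_real, norm_eq_abs, sq_abs]

theorem circleReflection_mem_ball {c : ℂ} {r : ℝ} (hr : 0 < r) {w : ℂ} (hw : r < ‖w - c‖) :
    circleReflection c r w ∈ ball c r := by
  rw [mem_ball_iff_norm, norm_circleReflection_sub, div_lt_iff₀ (hr.trans hw), sq]
  exact mul_lt_mul_of_pos_left hw hr

theorem differentiableAt_conj_comp_circleReflection {g : ℂ → ℂ} {c : ℂ} {r : ℝ} (hr : 0 < r)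
    (hg : DifferentiableOn ℂ g (ball c r)) {w : ℂ} (hw : r < ‖w - c‖) :
    DifferentiableAt ℂ (fun w => conj (g (circleReflection c r w))) w := by
  have hwc : w - c ≠ 0 := norm_pos_iff.1 (hr.trans hw)
  have h1 : DifferentiableAt ℂ (fun w => conj c + (r : ℂ) ^ 2 / (w - c)) w :=
    (differentiableAt_const _).add
      ((differentiableAt_const _).div (differentiableAt_id.sub_const c) hwc)
  have hconj : ∀ w, conj (conj c + (r : ℂ) ^ 2 / (w - c)) = circleReflection c r w := fun w => by
    simp [circleReflection]
  have h2 : DifferentiableAt ℂ g (conj (conj c + (r : ℂ) ^ 2 / (w - c))) := by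
    rw [hconj]
    exact hg.differentiableAt (isOpen_ball.mem_nhds (circleReflection_mem_ball hr hw))
  have h3 := h2.conj_conj
  rw [Complex.conj_conj] at h3
  refine (h3.comp w h1).congr_of_eventuallyEq (.of_forall fun w => ?_)
  simp only [Function.comp_apply, hconj]

theorem exists_norm_sub_circleReflection_lt {g : ℂ → ℂ} {c : ℂ} {r η ε : ℝ} (hr : 0 < r)
    (hη : 0 < η) (hg : ContinuousOn g (ball c (r + η))) (hε : 0 < ε) :
    ∃ t > r, ∀ w, r < ‖w - c‖ → ‖w - c‖ < t → ‖g w - g (circleReflection c r w)‖ < ε := by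
  have huc : UniformContinuousOn g (closedBall c (r + η / 2)) :=
    (isCompact_closedBall c _).uniformContinuousOn_of_continuous
      (hg.mono (closedBall_subset_ball (by linarith)))
  obtain ⟨δ, hδ, h⟩ := Metric.uniformContinuousOn_iff.1 huc ε hε
  refine ⟨min (r + η / 2) (r + δ / 2), lt_min (by linarith) (by linarith), fun w h1 h2 => ?_⟩
  obtain ⟨h3, h4⟩ := lt_min_iff.1 h2
  rw [← dist_eq_norm]
  refine h w (mem_closedBall_iff_norm.2 h3.le) _ ?_ ?_
  · exact closedBall_subset_closedBall (by linarith)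
      (ball_subset_closedBall (circleReflection_mem_ball hr h1))
  · set s := ‖w - c‖ with hs
    have hs0 : 0 < s := hr.trans h1
    have hwc : w - c ≠ 0 := norm_pos_iff.1 hs0
    have hcw : conj (w - c) ≠ 0 := (map_ne_zero _).2 hwc
    have hmul : (w - c) * conj (w - c) = (s : ℂ) ^ 2 := by
      rw [Complex.mul_conj, Complex.normSq_eq_norm_sq]; push_cast; rfl
    have heq : w - circleReflection c r w = ((s ^ 2 - r ^ 2 : ℝ) : ℂ) / conj (w - c) := by
      rw [circleReflection, eq_div_iff hcw, ← sub_sub, sub_mul, hmul, div_mul_cancel₀ _ hcw]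
      push_cast; rfl
    rw [dist_eq_norm, heq, norm_div, Complex.norm_conj, Complex.norm_real, norm_eq_abs, ← hs,
      abs_of_pos (by nlinarith), div_lt_iff₀ hs0]
    nlinarith

theorem conj_circleIntegral (F : ℂ → ℂ) (c : ℂ) {ρ : ℝ} (hρ : 0 < ρ) :
    conj (∮ ζ in C(c, ρ), F ζ) = -∮ ζ in C(c, ρ), ((ρ : ℂ) / (ζ - c)) ^ 2 * conj (F ζ) := by
  rw [circleIntegral, circleIntegral, ← intervalIntegral.integral_neg,
    intervalIntegral.integral_of_le two_pi_pos.le, intervalIntegral.integral_of_le two_pi_pos.le,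
    ← integral_conj]
  congr 1
  funext θ
  have h0 : circleMap 0 ρ θ ≠ 0 := by simpa using hρ.ne'
  have hmul : circleMap 0 ρ θ * conj (circleMap 0 ρ θ) = (ρ : ℂ) ^ 2 := by
    rw [Complex.mul_conj, Complex.normSq_eq_norm_sq, norm_circleMap_zero, sq_abs]; push_cast; rfl
  rw [deriv_circleMap, smul_eq_mul, smul_eq_mul, map_mul, map_mul, Complex.conj_I,
    circleMap_sub_center, div_pow, ← hmul]
  field_simp

/-- Data for a holomorphic map between complements of round holes that sends the boundary of the
`i`-th hole to the boundary of the `i`-th hole. -/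
structure IsHoleMap {ι : Type*} (c c' : ι → ℂ) (r r' R R' : ι → ℝ) (f : ℂ → ℂ) : Prop where
  r_pos : ∀ i, 0 < r i
  r_lt : ∀ i, r i < R i
  disj : ∀ i j, i ≠ j → Disjoint (ball (c i) (R i)) (ball (c j) (R j))
  r'_pos : ∀ i, 0 < r' i
  r'_lt : ∀ i, r' i < R' i
  sep' : ∀ i j, i ≠ j → ∀ w ∈ ball (c' j) (R' j), r' i < ‖w - c' i‖
  diff : ∀ z, (∀ i, r i < ‖z - c i‖) → DifferentiableAt ℂ f z
  mapsTo : ∀ z, (∀ i, r i < ‖z - c i‖) → ∀ i, r' i < ‖f z - c' i‖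
  bdry : ∀ i, ∀ s > r' i, ∃ t > r i, ∀ z, r i < ‖z - c i‖ → ‖z - c i‖ < t → ‖f z - c' i‖ < s

/-- A bound for the periods around the `j`-th hole of the forms `g (f ζ) u(ζ) dζ`, with `u`
holomorphic on the `j`-th source disc and `g` holomorphic on the `j`-th target disc. -/
def PeriodBound {ι : Type*} (c c' : ι → ℂ) (r r' : ι → ℝ) (f : ℂ → ℂ) (B : ι → ℝ) : Prop :=
  ∀ (j : ι) (u g : ℂ → ℂ) (M η : ℝ), 0 < η →
    DifferentiableOn ℂ u (ball (c j) (r j + η)) → (∀ z ∈ ball (c j) (r j + η), ‖u z‖ ≤ M) →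
    DifferentiableOn ℂ g (ball (c' j) (r' j + η)) → (∀ w ∈ ball (c' j) (r' j + η), ‖g w‖ ≤ 1) →
    ∀ᶠ ρ in 𝓝[>] (r j), ‖∮ ζ in C(c j, ρ), g (f ζ) * u ζ‖ ≤ M * B j

namespace IsHoleMap

variable {ι : Type*} {c c' : ι → ℂ} {r r' R R' : ι → ℝ} {f : ℂ → ℂ}

theorem mem_of_mem_collar (hf : IsHoleMap c c' r r' R R' f) {j : ι} {z : ℂ}
    (h1 : r j < ‖z - c j‖) (h2 : ‖z - c j‖ < R j) (i : ι) : r i < ‖z - c i‖ := by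
  by_cases hij : i = j
  · exact hij ▸ h1
  · have hz := (hf.disj j i (Ne.symm hij)).notMem_of_mem_left (mem_ball_iff_norm.2 h2)
    rw [mem_ball_iff_norm, not_lt] at hz
    exact (hf.r_lt i).trans_le hz

theorem eventually_period_eq (hf : IsHoleMap c c' r r' R R' f) {j : ι} {u g : ℂ → ℂ} {η : ℝ}
    (hη : 0 < η) (hu : DifferentiableOn ℂ u (ball (c j) (r j + η)))
    (hg : DifferentiableOn ℂ g (ball (c' j) (r' j + η))) :
    ∃ t > r j, t ≤ R j ∧ t ≤ r j + η ∧
      (∀ z, r j < ‖z - c j‖ → ‖z - c j‖ < t → f z ∈ ball (c' j) (r' j + η)) ∧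
      ContinuousOn (fun ζ => g (f ζ) * u ζ) (ball (c j) t \ closedBall (c j) (r j)) ∧
      ∀ ρ₁ ρ₂, r j < ρ₁ → ρ₁ ≤ ρ₂ → ρ₂ < t →
        (∮ ζ in C(c j, ρ₂), g (f ζ) * u ζ) = ∮ ζ in C(c j, ρ₁), g (f ζ) * u ζ := by
  obtain ⟨t₀, ht₀, h⟩ := hf.bdry j (r' j + η) (by linarith)
  have h1 : min t₀ (min (R j) (r j + η)) ≤ t₀ := min_le_left _ _
  have h2 : min t₀ (min (R j) (r j + η)) ≤ R j := (min_le_right _ _).trans (min_le_left _ _)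
  have h3 : min t₀ (min (R j) (r j + η)) ≤ r j + η := (min_le_right _ _).trans (min_le_right _ _)
  have h4 : r j < min t₀ (min (R j) (r j + η)) :=
    lt_min ht₀ (lt_min (hf.r_lt j) (by linarith))
  generalize min t₀ (min (R j) (r j + η)) = t at h1 h2 h3 h4
  have hd : DifferentiableOn ℂ (fun ζ => g (f ζ) * u ζ) (ball (c j) t \ closedBall (c j) (r j)) := by
    intro z hz
    have hz1 : ‖z - c j‖ < t := mem_ball_iff_norm.1 hz.1
    have hz2 : r j < ‖z - c j‖ := by simpa [dist_eq_norm] using hz.2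
    refine DifferentiableAt.differentiableWithinAt (DifferentiableAt.mul ?_ ?_)
    · refine DifferentiableAt.comp z (hg.differentiableAt (isOpen_ball.mem_nhds ?_))
        (hf.diff z (hf.mem_of_mem_collar hz2 (by linarith)))
      exact mem_ball_iff_norm.2 (h z hz2 (by linarith))
    · exact hu.differentiableAt (isOpen_ball.mem_nhds (mem_ball_iff_norm.2 (by linarith)))
  exact ⟨t, h4, h2, h3, fun z hz1 hz2 => mem_ball_iff_norm.2 (h z hz1 (by linarith)),
    hd.continuousOn, fun ρ₁ ρ₂ k1 k2 k3 =>
    circleIntegral_eq_of_annulus (hf.r_pos j).le k1 k2 k3 hd⟩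

theorem periodBound_init (hf : IsHoleMap c c' r r' R R' f) :
    PeriodBound c c' r r' f fun j => 2 * π * R j := by
  intro j u g M η hη hu huM hg hg1
  obtain ⟨t, ht, htR, htη, hft, -, -⟩ := hf.eventually_period_eq hη hu hg
  filter_upwards [Ioo_mem_nhdsGT ht] with ρ hρ
  have hρ0 : 0 ≤ ρ := (hf.r_pos j).le.trans hρ.1.le
  have hM : 0 ≤ M := (norm_nonneg _).trans
    (huM (c j) (mem_ball_self (by linarith [hf.r_pos j])))
  calc ‖∮ ζ in C(c j, ρ), g (f ζ) * u ζ‖ ≤ 2 * π * ρ * (1 * M) := by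
        refine circleIntegral.norm_integral_le_of_norm_le_const hρ0 fun ζ hζ => ?_
        rw [mem_sphere_iff_norm] at hζ
        rw [norm_mul]
        gcongr
        · exact hg1 _ (hft ζ (by linarith [hρ.1]) (by linarith [hρ.2]))
        · exact huM _ (mem_ball_iff_norm.2 (by linarith [hρ.2]))
    _ ≤ M * (2 * π * R j) := by
        rw [one_mul, mul_comm]
        gcongr
        linarith [hρ.2]

theorem norm_period_le_of_differentiableAt [Fintype ι] (hf : IsHoleMap c c' r r' R R' f)
    {κ B : ι → ℝ} (hκ0 : ∀ i, 0 ≤ κ i)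
    (hκ : ∀ i j, i ≠ j → ∀ z ∈ ball (c i) (R i), r j ^ 2 ≤ κ j * ‖z - c j‖ ^ 2)
    (hB0 : ∀ i, 0 ≤ B i) (hB : PeriodBound c c' r r' f B) {j : ι} {G V : ℂ → ℂ} {M : ℝ}
    (hM : 0 ≤ M) (hGd : ∀ w, r' j < ‖w - c' j‖ → DifferentiableAt ℂ G w)
    (hVd : ∀ z, r j < ‖z - c j‖ → DifferentiableAt ℂ V z)
    (hG1 : ∀ w, r' j < ‖w - c' j‖ → ‖G w‖ ≤ 1)
    (hVM : ∀ z, r j < ‖z - c j‖ → ‖V z‖ ≤ r j ^ 2 / ‖z - c j‖ ^ 2 * M) {ρ : ℝ}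
    (h1 : r j < ρ) (h2 : ρ < R j) :
    ‖∮ ζ in C(c j, ρ), G (f ζ) * V ζ‖ ≤ M * (κ j * ∑ i, B i) := by
  classical
  have hrj := hf.r_pos j
  -- the reflected form has no residue at infinity
  have hres : ∀ ρ : ι → ℝ, (∀ i, r i < ρ i) → (∀ i, ρ i < R i) →
      ∑ i, ∮ ζ in C(c i, ρ i), G (f ζ) * V ζ = 0 := by
    intro ρ hρ1 hρ2
    have := sum_circleIntegral_of_holes c r ρ R (fun i => (hf.r_pos i).le) hρ1 hρ2 hf.disj
      Finset.univ (fun ζ => G (f ζ) * V ζ) 0 ?_ ?_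
    · simpa using this
    · intro z hz
      have hz' : ∀ i, r i < ‖z - c i‖ := by simpa [dist_eq_norm] using hz
      exact (((hGd _ (hf.mapsTo z hz' j)).comp z (hf.diff z hz')).mul
        (hVd z (hz' j))).differentiableWithinAt
    · have hlim : Tendsto (fun z : ℂ => 4 * r j ^ 2 * M * ‖z‖⁻¹) (Bornology.cobounded ℂ) (𝓝 0) := by
        simpa using (tendsto_inv_atTop_zero.comp
          (tendsto_norm_cobounded_atTop (E := ℂ))).const_mul (4 * r j ^ 2 * M)
      refine squeeze_zero_norm' ?_ hlim
      have hfar : ∀ i, ∀ᶠ z in Bornology.cobounded ℂ, r i < ‖z - c i‖ := fun i => by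
        have h1 : (closedBall (c i) (r i))ᶜ ∈ Bornology.cobounded ℂ :=
          Bornology.isBounded_def.1 isBounded_closedBall
        filter_upwards [h1] with z hz
        simpa [dist_eq_norm] using hz
      filter_upwards [eventually_all.2 hfar,
        (tendsto_norm_cobounded_atTop (E := ℂ)).eventually_gt_atTop (2 * ‖c j‖)] with z hz hz2
      have h0 : 0 < ‖z‖ := by linarith [norm_nonneg (c j)]
      have h2 : ‖z‖ / 2 ≤ ‖z - c j‖ := by linarith [norm_sub_norm_le z (c j)]
      rw [norm_mul, norm_mul]
      calc ‖z‖ * (‖G (f z)‖ * ‖V z‖) ≤ ‖z‖ * (1 * (r j ^ 2 / (‖z‖ / 2) ^ 2 * M)) := by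
            gcongr
            · exact hG1 _ (hf.mapsTo z hz j)
            · refine (hVM z (hz j)).trans ?_
              gcongr
        _ = 4 * r j ^ 2 * M * ‖z‖⁻¹ := by field_simp; ring
  have hother : ∀ i, ∃ ρ, r i < ρ ∧ ρ < R i ∧
      (i ≠ j → ‖∮ ζ in C(c i, ρ), G (f ζ) * V ζ‖ ≤ κ j * M * B i) := by
    intro i
    have hmem := Ioo_mem_nhdsGT (hf.r_lt i)
    by_cases hij : i = j
    · obtain ⟨ρ, hρ⟩ := Filter.nonempty_of_mem hmem
      exact ⟨ρ, hρ.1, hρ.2, fun h => absurd hij h⟩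
    · have h1 : r i + min (R i - r i) (R' i - r' i) ≤ R i := by
        linarith [min_le_left (R i - r i) (R' i - r' i)]
      have h2 : r' i + min (R i - r i) (R' i - r' i) ≤ R' i := by
        linarith [min_le_right (R i - r i) (R' i - r' i)]
      have hzj : ∀ z ∈ ball (c i) (R i), r j < ‖z - c j‖ := fun z hz => by
        have := (hf.disj i j hij).notMem_of_mem_left hz
        rw [mem_ball_iff_norm, not_lt] at this
        exact (hf.r_lt j).trans_le this
      have hwj := hf.sep' j i (Ne.symm hij)
      have := hB i V G (κ j * M) (min (R i - r i) (R' i - r' i))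
        (lt_min (sub_pos.2 (hf.r_lt i)) (sub_pos.2 (hf.r'_lt i)))
        (fun z hz => (hVd z (hzj z (ball_subset_ball h1 hz))).differentiableWithinAt)
        (fun z hz => by
          have hz' := ball_subset_ball h1 hz
          refine (hVM z (hzj z hz')).trans ?_
          gcongr
          rw [div_le_iff₀ (by have := hrj.trans (hzj z hz'); positivity)]
          exact hκ i j hij z hz')
        (fun w hw => (hGd w (hwj w (ball_subset_ball h2 hw))).differentiableWithinAt)
        (fun w hw => hG1 w (hwj w (ball_subset_ball h2 hw)))
      obtain ⟨ρ, hρ1, hρ2⟩ := (this.and hmem).exists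
      exact ⟨ρ, hρ2.1, hρ2.2, fun _ => hρ1⟩
  choose ρ' hρ'1 hρ'2 hρ'3 using hother
  have := hres (Function.update ρ' j ρ)
    (fun i => by by_cases h : i = j; · subst h; simpa using h1
                 · simpa [h] using hρ'1 i)
    (fun i => by by_cases h : i = j; · subst h; simpa using h2
                 · simpa [h] using hρ'2 i)
  rw [← Finset.add_sum_erase _ _ (Finset.mem_univ j), Function.update_self] at this
  rw [eq_neg_of_add_eq_zero_left this, norm_neg]
  calc ‖∑ i ∈ Finset.univ.erase j, ∮ ζ in C(c i, Function.update ρ' j ρ i), G (f ζ) * V ζ‖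
      ≤ ∑ i ∈ Finset.univ.erase j, κ j * M * B i := by
        refine norm_sum_le_of_le _ fun i hi => ?_
        rw [Function.update_of_ne (Finset.ne_of_mem_erase hi)]
        exact hρ'3 i (Finset.ne_of_mem_erase hi)
    _ ≤ ∑ i, κ j * M * B i :=
        Finset.sum_le_sum_of_subset_of_nonneg (Finset.erase_subset _ _)
          fun i _ _ => mul_nonneg (mul_nonneg (hκ0 j) hM) (hB0 i)
    _ = M * (κ j * ∑ i, B i) := by rw [← Finset.mul_sum]; ring

theorem exists_norm_conj_sub_reflection_le (hf : IsHoleMap c c' r r' R R' f) {j : ι}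
    {u g G V : ℂ → ℂ} {M η : ℝ} (hη : 0 < η) (hu : DifferentiableOn ℂ u (ball (c j) (r j + η)))
    (huM : ∀ z ∈ ball (c j) (r j + η), ‖u z‖ ≤ M)
    (hg : DifferentiableOn ℂ g (ball (c' j) (r' j + η)))
    (hg1 : ∀ w ∈ ball (c' j) (r' j + η), ‖g w‖ ≤ 1)
    (hG : ∀ w, G w = conj (g (circleReflection (c' j) (r' j) w)))
    (hV : ∀ ζ, V ζ =
      ((r j : ℂ) / (ζ - c j)) ^ 2 * conj (u (circleReflection (c j) (r j) ζ))) {ε : ℝ}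
    (hε : 0 < ε) :
    ∃ t' > r j, ∀ ζ, r j < ‖ζ - c j‖ → ‖ζ - c j‖ < t' →
      ‖((‖ζ - c j‖ : ℂ) / (ζ - c j)) ^ 2 * conj (g (f ζ) * u ζ) - G (f ζ) * V ζ‖
        ≤ ε * (2 * M + 1) := by
  have hrj := hf.r_pos j
  have hr'j := hf.r'_pos j
  have hM : 0 ≤ M := (norm_nonneg _).trans (huM (c j) (mem_ball_self (by linarith)))
  obtain ⟨t, ht, htR, htη, hft, -, -⟩ := hf.eventually_period_eq hη hu hg
  have hG1 : ∀ w, r' j < ‖w - c' j‖ → ‖g (circleReflection (c' j) (r' j) w)‖ ≤ 1 := fun w hw =>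
    hg1 _ (ball_subset_ball (by linarith) (circleReflection_mem_ball hr'j hw))
  have huR : ∀ z, r j < ‖z - c j‖ → ‖u (circleReflection (c j) (r j) z)‖ ≤ M := fun z hz =>
    huM _ (ball_subset_ball (by linarith) (circleReflection_mem_ball hrj hz))
  obtain ⟨t₁, ht₁, hu'⟩ := exists_norm_sub_circleReflection_lt hrj hη hu.continuousOn hε
  obtain ⟨s, hs, hg'⟩ := exists_norm_sub_circleReflection_lt hr'j hη hg.continuousOn hε
  obtain ⟨t₂, ht₂, hf'⟩ := hf.bdry j s hs
  refine ⟨min (min t₁ t₂) (min t (r j + ε * r j / 2)), lt_min (lt_min ht₁ ht₂)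
    (lt_min ht (by have := mul_pos hε hrj; linarith)), fun ζ h1 h2 => ?_⟩
  simp only [lt_min_iff] at h2
  obtain ⟨⟨h2, h3⟩, h4, h5⟩ := h2
  have hζ := hf.mem_of_mem_collar h1 (h4.trans_le htR)
  have e1 := (hu' ζ h1 h2).le
  have e2 := (hg' (f ζ) (hf.mapsTo ζ hζ j) (hf' ζ h1 h3)).le
  have n1 : ‖g (f ζ)‖ ≤ 1 := hg1 _ (hft ζ h1 h4)
  have n2 : ‖u ζ‖ ≤ M := huM _ (mem_ball_iff_norm.2 (by linarith))
  have n3 := huR ζ h1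
  have n4 : ‖g (circleReflection (c' j) (r' j) (f ζ))‖ ≤ 1 :=
    hG1 _ (hf.mapsTo ζ hζ j)
  set p := ‖ζ - c j‖ with hp
  have hp0 : 0 < p := hrj.trans h1
  have hne : ζ - c j ≠ 0 := norm_pos_iff.1 hp0
  have hq : 1 - r j ^ 2 / p ^ 2 ≤ ε := by
    rw [sub_le_iff_le_add, ← sub_le_iff_le_add', le_div_iff₀ (by positivity)]
    nlinarith [mul_pos hε hrj, mul_pos hε hp0, mul_pos hrj hp0]
  have hq0 : 0 ≤ 1 - r j ^ 2 / p ^ 2 := by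
    rw [sub_nonneg, div_le_one (by positivity)]
    gcongr
  have hexp : ((p : ℂ) / (ζ - c j)) ^ 2 * conj (g (f ζ) * u ζ) - G (f ζ) * V ζ =
      ((p : ℂ) / (ζ - c j)) ^ 2 * (conj ((g (f ζ) - g (circleReflection (c' j) (r' j) (f ζ))) * u ζ
        + g (circleReflection (c' j) (r' j) (f ζ)) * (u ζ - u (circleReflection (c j) (r j) ζ)))
        + ((1 - r j ^ 2 / p ^ 2 : ℝ) : ℂ) * conj (g (circleReflection (c' j) (r' j) (f ζ)) *
          u (circleReflection (c j) (r j) ζ))) := by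
    have hpc : (p : ℂ) ≠ 0 := by exact_mod_cast hp0.ne'
    simp only [hG, hV, map_mul, map_add, map_sub]
    push_cast
    field_simp
    ring
  rw [hexp, norm_mul, norm_pow, norm_div, Complex.norm_real, norm_eq_abs, abs_of_pos hp0, ← hp,
    div_self hp0.ne', one_pow, one_mul]
  refine (norm_add_le _ _).trans ?_
  rw [Complex.norm_conj, norm_mul _ (conj _), Complex.norm_conj, Complex.norm_real, norm_eq_abs,
    abs_of_nonneg hq0, norm_mul (g _)]
  have m1 := norm_add_le ((g (f ζ) - g (circleReflection (c' j) (r' j) (f ζ))) * u ζ)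
    (g (circleReflection (c' j) (r' j) (f ζ)) * (u ζ - u (circleReflection (c j) (r j) ζ)))
  rw [norm_mul, norm_mul] at m1
  have m2 : ‖g (f ζ) - g (circleReflection (c' j) (r' j) (f ζ))‖ * ‖u ζ‖ ≤ ε * M := by gcongr
  have m3 : ‖g (circleReflection (c' j) (r' j) (f ζ))‖ *
    ‖u ζ - u (circleReflection (c j) (r j) ζ)‖ ≤ 1 * ε := by gcongr
  have m4 : (1 - r j ^ 2 / p ^ 2) * (‖g (circleReflection (c' j) (r' j) (f ζ))‖ *
    ‖u (circleReflection (c j) (r j) ζ)‖) ≤ ε * (1 * M) := by gcongr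
  linarith

theorem periodBound_step [Fintype ι] (hf : IsHoleMap c c' r r' R R' f) {κ B : ι → ℝ}
    (hκ0 : ∀ i, 0 ≤ κ i)
    (hκ : ∀ i j, i ≠ j → ∀ z ∈ ball (c i) (R i), r j ^ 2 ≤ κ j * ‖z - c j‖ ^ 2)
    (hB0 : ∀ i, 0 ≤ B i) (hB : PeriodBound c c' r r' f B) :
    PeriodBound c c' r r' f fun j => κ j * ∑ i, B i := by
  intro j u g M η hη hu huM hg hg1
  have hrj := hf.r_pos j
  have hr'j := hf.r'_pos j
  have hM : 0 ≤ M := (norm_nonneg _).trans (huM (c j) (mem_ball_self (by linarith)))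
  obtain ⟨t, ht, htR, htη, hft, hcont, hconst⟩ := hf.eventually_period_eq hη hu hg
  obtain ⟨G, hG⟩ : ∃ G : ℂ → ℂ, ∀ w, G w = conj (g (circleReflection (c' j) (r' j) w)) :=
    ⟨_, fun _ => rfl⟩
  obtain ⟨V, hV⟩ : ∃ V : ℂ → ℂ, ∀ ζ, V ζ =
      ((r j : ℂ) / (ζ - c j)) ^ 2 * conj (u (circleReflection (c j) (r j) ζ)) := ⟨_, fun _ => rfl⟩
  have hGd : ∀ w, r' j < ‖w - c' j‖ → DifferentiableAt ℂ G w := fun w hw => by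
    rw [funext hG]
    exact differentiableAt_conj_comp_circleReflection hr'j
      (hg.mono (ball_subset_ball (by linarith))) hw
  have hVd : ∀ z, r j < ‖z - c j‖ → DifferentiableAt ℂ V z := fun z hz => by
    rw [funext hV]
    have hne : z - c j ≠ 0 := norm_pos_iff.1 (hrj.trans hz)
    have hz1 : DifferentiableAt ℂ (fun ζ => ((r j : ℂ) / (ζ - c j)) ^ 2) z := by
      fun_prop (disch := exact hne)
    exact hz1.fun_mul (differentiableAt_conj_comp_circleReflection hrj
      (hu.mono (ball_subset_ball (by linarith))) hz)
  have hG1 : ∀ w, r' j < ‖w - c' j‖ → ‖G w‖ ≤ 1 := fun w hw => by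
    rw [hG, Complex.norm_conj]
    exact hg1 _ (ball_subset_ball (by linarith) (circleReflection_mem_ball hr'j hw))
  have huR : ∀ z, r j < ‖z - c j‖ → ‖u (circleReflection (c j) (r j) z)‖ ≤ M := fun z hz =>
    huM _ (ball_subset_ball (by linarith) (circleReflection_mem_ball hrj hz))
  have hVM : ∀ z, r j < ‖z - c j‖ → ‖V z‖ ≤ r j ^ 2 / ‖z - c j‖ ^ 2 * M := fun z hz => by
    rw [hV, norm_mul, norm_pow, norm_div, Complex.norm_conj, Complex.norm_real, norm_eq_abs,
      div_pow, sq_abs]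
    gcongr
    exact huR z hz
  have hHbound : ∀ ρ, r j < ρ → ρ < R j →
      ‖∮ ζ in C(c j, ρ), G (f ζ) * V ζ‖ ≤ M * (κ j * ∑ i, B i) := fun ρ h1 h2 =>
    hf.norm_period_le_of_differentiableAt hκ0 hκ hB0 hB hM hGd hVd hG1 hVM h1 h2
  have hclose : ∀ ε > 0, ∃ t' > r j, ∀ ζ, r j < ‖ζ - c j‖ → ‖ζ - c j‖ < t' →
      ‖((‖ζ - c j‖ : ℂ) / (ζ - c j)) ^ 2 * conj (g (f ζ) * u ζ) - G (f ζ) * V ζ‖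
        ≤ ε * (2 * M + 1) := fun ε hε =>
    hf.exists_norm_conj_sub_reflection_le hη hu huM hg hg1 hG hV hε
  filter_upwards [Ioo_mem_nhdsGT ht] with ρ hρ
  refine le_of_forall_pos_le_add fun ε hε => ?_
  have hK : 0 < 2 * π * R j * (2 * M + 1) := by
    have := hrj.trans (hf.r_lt j)
    positivity
  obtain ⟨t', ht', hcl⟩ := hclose (ε / (2 * π * R j * (2 * M + 1))) (div_pos hε hK)
  obtain ⟨ρ₁, hρ₁, hρ₁t, hρ₁ρ⟩ : ∃ ρ₁, r j < ρ₁ ∧ ρ₁ < t' ∧ ρ₁ ≤ ρ := by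
    obtain ⟨x, hx1, hx2⟩ := exists_between (lt_min ht' hρ.1)
    exact ⟨x, hx1, hx2.trans_le (min_le_left _ _), (hx2.trans_le (min_le_right _ _)).le⟩
  have hρ₁0 : 0 < ρ₁ := hrj.trans hρ₁
  have hρ₁R : ρ₁ < R j := by linarith [hρ.2]
  rw [hconst ρ₁ ρ hρ₁ hρ₁ρ hρ.2, ← Complex.norm_conj, conj_circleIntegral _ _ hρ₁0, norm_neg]
  have hsph : ∀ ζ ∈ sphere (c j) ρ₁, ζ ∈ ball (c j) t \ closedBall (c j) (r j) := fun ζ hζ => by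
    rw [mem_sphere_iff_norm] at hζ
    simp only [Set.mem_sdiff, mem_ball, mem_closedBall, dist_eq_norm, hζ]
    constructor <;> linarith [hρ.2]
  have hne : ∀ ζ ∈ sphere (c j) ρ₁, ζ - c j ≠ 0 := fun ζ hζ =>
    norm_pos_iff.1 (by rw [mem_sphere_iff_norm.1 hζ]; exact hρ₁0)
  have hi1 : CircleIntegrable (fun ζ => ((ρ₁ : ℂ) / (ζ - c j)) ^ 2 * conj (g (f ζ) * u ζ))
      (c j) ρ₁ := by
    refine ContinuousOn.circleIntegrable hρ₁0.le (ContinuousOn.mul ?_ ?_)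
    · exact (continuousOn_const.div (by fun_prop) hne).pow 2
    · exact Complex.continuous_conj.comp_continuousOn (hcont.mono hsph)
  have hi2 : CircleIntegrable (fun ζ => G (f ζ) * V ζ) (c j) ρ₁ := by
    refine ContinuousOn.circleIntegrable hρ₁0.le fun ζ hζ => ContinuousAt.continuousWithinAt ?_
    have h1 : r j < ‖ζ - c j‖ := by rw [mem_sphere_iff_norm.1 hζ]; exact hρ₁
    have h2 := hf.mem_of_mem_collar h1 (by rw [mem_sphere_iff_norm.1 hζ]; exact hρ₁R)
    exact (((hGd _ (hf.mapsTo ζ h2 j)).comp ζ (hf.diff ζ h2)).mul (hVd ζ h1)).continuousAt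
  have hdiff : ‖(∮ ζ in C(c j, ρ₁), ((ρ₁ : ℂ) / (ζ - c j)) ^ 2 * conj (g (f ζ) * u ζ)) -
      ∮ ζ in C(c j, ρ₁), G (f ζ) * V ζ‖ ≤ ε := by
    rw [← circleIntegral.integral_sub hi1 hi2]
    calc _ ≤ 2 * π * ρ₁ * (ε / (2 * π * R j * (2 * M + 1)) * (2 * M + 1)) := by
          refine circleIntegral.norm_integral_le_of_norm_le_const hρ₁0.le fun ζ hζ => ?_
          rw [mem_sphere_iff_norm] at hζ
          have := hcl ζ (by rwa [hζ]) (by rwa [hζ])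
          rwa [hζ] at this
      _ ≤ 2 * π * R j * (ε / (2 * π * R j * (2 * M + 1)) * (2 * M + 1)) := by gcongr
      _ = ε := by
          have : 2 * M + 1 ≠ 0 := by positivity
          have : R j ≠ 0 := (hrj.trans (hf.r_lt j)).ne'
          field_simp
  have := norm_sub_norm_le (∮ ζ in C(c j, ρ₁), ((ρ₁ : ℂ) / (ζ - c j)) ^ 2 * conj (g (f ζ) * u ζ))
    (∮ ζ in C(c j, ρ₁), G (f ζ) * V ζ)
  linarith [hHbound ρ₁ hρ₁ hρ₁R]

theorem eventually_period_eq_zero [Fintype ι] (hf : IsHoleMap c c' r r' R R' f) {κ : ι → ℝ}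
    (hκ0 : ∀ i, 0 ≤ κ i)
    (hκ : ∀ i j, i ≠ j → ∀ z ∈ ball (c i) (R i), r j ^ 2 ≤ κ j * ‖z - c j‖ ^ 2)
    (hκ1 : ∑ i, κ i < 1) {j : ι} {u g : ℂ → ℂ} {M η : ℝ} (hη : 0 < η)
    (hu : DifferentiableOn ℂ u (ball (c j) (r j + η))) (huM : ∀ z ∈ ball (c j) (r j + η), ‖u z‖ ≤ M)
    (hg : DifferentiableOn ℂ g (ball (c' j) (r' j + η)))
    (hg1 : ∀ w ∈ ball (c' j) (r' j + η), ‖g w‖ ≤ 1) :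
    ∀ᶠ ρ in 𝓝[>] (r j), (∮ ζ in C(c j, ρ), g (f ζ) * u ζ) = 0 := by
  set S := ∑ i, 2 * π * R i
  have hR0 : ∀ i, 0 ≤ 2 * π * R i := fun i => by
    have := (hf.r_pos i).trans (hf.r_lt i)
    positivity
  have hS : 0 ≤ S := Finset.sum_nonneg fun i _ => hR0 i
  have hs : 0 ≤ ∑ i, κ i := Finset.sum_nonneg fun i _ => hκ0 i
  have hn : ∀ n : ℕ, PeriodBound c c' r r' f fun j => κ j * ((∑ i, κ i) ^ n * S) := by
    intro n
    induction n with
    | zero => simpa using hf.periodBound_step hκ0 hκ hR0 hf.periodBound_init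
    | succ n ih =>
      have := hf.periodBound_step hκ0 hκ
        (fun i => mul_nonneg (hκ0 i) (mul_nonneg (pow_nonneg hs n) hS)) ih
      rw [← Finset.sum_mul] at this
      convert this using 3
      ring
  obtain ⟨t, ht, -, -, -, -, hconst⟩ := hf.eventually_period_eq hη hu hg
  filter_upwards [Ioo_mem_nhdsGT ht] with ρ hρ
  have hle : ∀ n : ℕ, ‖∮ ζ in C(c j, ρ), g (f ζ) * u ζ‖ ≤ M * (κ j * ((∑ i, κ i) ^ n * S)) := by
    intro n
    obtain ⟨ρ₁, h1, h2⟩ := ((hn n j u g M η hη hu huM hg hg1).and (Ioo_mem_nhdsGT hρ.1)).exists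
    rwa [hconst ρ₁ ρ h2.1 h2.2.le hρ.2]
  have hlim : Tendsto (fun n : ℕ => M * (κ j * ((∑ i, κ i) ^ n * S))) atTop (𝓝 0) := by
    simpa using (((tendsto_pow_atTop_nhds_zero_of_lt_one hs hκ1).mul_const S).const_mul
      (κ j)).const_mul M
  exact norm_le_zero_iff.1 (ge_of_tendsto' hlim hle)

theorem eq_affine [Fintype ι] [DecidableEq ι] (hf : IsHoleMap c c' r r' R R' f) {κ : ι → ℝ}
    (hκ0 : ∀ i, 0 ≤ κ i)
    (hκ : ∀ i j, i ≠ j → ∀ z ∈ ball (c i) (R i), r j ^ 2 ≤ κ j * ‖z - c j‖ ^ 2)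
    (hκ1 : ∑ i, κ i < 1) {a b : ℂ}
    (hinf : Tendsto (fun z => f z - a * z) (Bornology.cobounded ℂ) (𝓝 b))
    {z : ℂ} (hz : ∀ i, r i < ‖z - c i‖) : f z = a * z + b := by
  set k : ℂ → ℂ := fun ζ => f ζ - a * ζ - b with hk
  have hkd : ∀ ζ, (∀ i, r i < ‖ζ - c i‖) → DifferentiableAt ℂ k ζ := fun ζ hζ =>
    ((hf.diff ζ hζ).sub (differentiableAt_id.const_mul a)).sub_const b
  have hset : ∀ ζ, ζ ∈ (⋃ i ∈ (Finset.univ : Finset ι), closedBall (c i) (r i))ᶜ ↔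
      ∀ i, r i < ‖ζ - c i‖ := fun ζ => by simp [dist_eq_norm]
  have hopen : IsOpen (⋃ i ∈ (Finset.univ : Finset ι), closedBall (c i) (r i))ᶜ := by
    rw [isOpen_compl_iff]
    exact Finset.univ.finite_toSet.isClosed_biUnion fun i _ => isClosed_closedBall
  have hd : DifferentiableOn ℂ (dslope k z)
      (⋃ i ∈ (Finset.univ : Finset ι), closedBall (c i) (r i))ᶜ :=
    (Complex.differentiableOn_dslope (hopen.mem_nhds ((hset z).2 hz))).2 fun ζ hζ =>
      (hkd ζ ((hset ζ).1 hζ)).differentiableWithinAt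
  have hk0 : Tendsto k (Bornology.cobounded ℂ) (𝓝 0) := by simpa using hinf.sub_const b
  have hlim : Tendsto (fun ζ => ζ * dslope k z ζ) (Bornology.cobounded ℂ) (𝓝 (-k z)) := by
    have h1 : Tendsto (fun ζ : ℂ => 1 - z * ζ⁻¹) (Bornology.cobounded ℂ) (𝓝 (1 - z * 0)) :=
      (tendsto_inv₀_cobounded.const_mul z).const_sub 1
    rw [mul_zero, sub_zero] at h1
    have h2 := (hk0.sub_const (k z)).div h1 one_ne_zero
    rw [zero_sub, div_one] at h2
    refine h2.congr' ?_
    filter_upwards [Bornology.eventually_ne_cobounded (0 : ℂ),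
      Bornology.eventually_ne_cobounded z] with ζ h0 hζz
    have : ζ - z ≠ 0 := sub_ne_zero.2 hζz
    rw [Pi.div_apply, dslope_of_ne _ hζz, slope_def_field]
    field_simp
  have hper : ∀ i, ∃ ρ, r i < ρ ∧ ρ < R i ∧ (∮ ζ in C(c i, ρ), dslope k z ζ) = 0 := by
    intro i
    set η := min ((‖z - c i‖ - r i) / 2) 1 with hη
    have hη0 : 0 < η := lt_min (by linarith [hz i]) one_pos
    have hη1 : η ≤ 1 := min_le_right _ _
    have hη2 : r i + 2 * η ≤ ‖z - c i‖ := by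
      linarith [min_le_left ((‖z - c i‖ - r i) / 2) 1]
    set T : ℝ := ‖c' i‖ + r' i + 1 with hT
    have hT0 : 0 < T := by have := hf.r'_pos i; positivity
    have hTc : (T : ℂ) ≠ 0 := by exact_mod_cast hT0.ne'
    have hfar : ∀ ζ ∈ ball (c i) (r i + η), η ≤ ‖ζ - z‖ := fun ζ hζ => by
      rw [mem_ball_iff_norm] at hζ
      have := norm_sub_le (ζ - c i) (ζ - z)
      rw [sub_sub_sub_cancel_left] at this
      linarith
    have hne : ∀ ζ ∈ ball (c i) (r i + η), ζ - z ≠ 0 := fun ζ hζ =>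
      norm_pos_iff.1 (hη0.trans_le (hfar ζ hζ))
    have hev := hf.eventually_period_eq_zero hκ0 hκ hκ1 (j := i) (u := fun ζ => T / (ζ - z))
      (g := fun w => w / T) (M := T / η) hη0
      (fun ζ hζ => ((differentiableAt_const _).div (differentiableAt_id.sub_const z)
        (hne ζ hζ)).differentiableWithinAt)
      (fun ζ hζ => by
        rw [norm_div, Complex.norm_real, norm_eq_abs, abs_of_pos hT0]
        have := hfar ζ hζ
        gcongr)
      (by fun_prop)
      (fun w hw => by
        rw [norm_div, Complex.norm_real, norm_eq_abs, abs_of_pos hT0, div_le_one hT0]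
        rw [mem_ball_iff_norm] at hw
        linarith [norm_le_norm_add_norm_sub (c' i) w, norm_sub_rev w (c' i)])
    have hmem1 : ∀ᶠ ρ in 𝓝[>] (r i), ρ ∈ Ioo (r i) (R i) := Ioo_mem_nhdsGT (hf.r_lt i)
    have hmem2 : ∀ᶠ ρ in 𝓝[>] (r i), ρ ∈ Ioo (r i) (r i + η) := Ioo_mem_nhdsGT (by linarith)
    obtain ⟨ρ, h0, hρ1, hρ2⟩ := (hev.and (hmem1.and hmem2)).exists
    refine ⟨ρ, hρ1.1, hρ1.2, ?_⟩
    have hρ0 : 0 ≤ ρ := (hf.r_pos i).le.trans hρ1.1.le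
    have hball : closedBall (c i) ρ ⊆ ball (c i) (r i + η) := closedBall_subset_ball hρ2.2
    have hd1 : ∀ ζ ∈ closedBall (c i) ρ,
        DifferentiableAt ℂ (fun ζ => (a * ζ + b + k z) / (ζ - z)) ζ := fun ζ hζ =>
      DifferentiableAt.div (by fun_prop) (by fun_prop) (hne ζ (hball hζ))
    have hc1 : ContinuousOn (fun ζ => (a * ζ + b + k z) / (ζ - z)) (closedBall (c i) ρ) :=
      fun ζ hζ => (hd1 ζ hζ).continuousAt.continuousWithinAt
    have h1 : (∮ ζ in C(c i, ρ), (a * ζ + b + k z) / (ζ - z)) = 0 :=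
      Complex.circleIntegral_eq_zero_of_differentiable_on_off_countable hρ0 countable_empty hc1
        fun ζ hζ => hd1 ζ (ball_subset_closedBall hζ.1)
    have hsub := sphere_subset_closedBall (x := c i) (ε := ρ)
    have hfc : ContinuousOn (fun ζ => f ζ / T * (T / (ζ - z))) (sphere (c i) ρ) := fun ζ hζ => by
      have h2 := mem_sphere_iff_norm.1 hζ
      refine ContinuousAt.continuousWithinAt (DifferentiableAt.continuousAt (𝕜 := ℂ) ?_)
      refine DifferentiableAt.mul (DifferentiableAt.div_const (hf.diff ζ ?_) _)
        (DifferentiableAt.div (by fun_prop) (by fun_prop) (hne ζ (hball (hsub hζ))))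
      exact hf.mem_of_mem_collar (by rw [h2]; exact hρ1.1) (by rw [h2]; exact hρ1.2)
    have hcongr : EqOn (dslope k z)
        (fun ζ => f ζ / T * (T / (ζ - z)) - (a * ζ + b + k z) / (ζ - z)) (sphere (c i) ρ) := by
      intro ζ hζ
      have hζz := hne ζ (hball (hsub hζ))
      rw [dslope_of_ne _ (sub_ne_zero.1 hζz), slope_def_field]
      simp only [hk]
      field_simp
      ring
    rw [circleIntegral.integral_congr hρ0 hcongr, circleIntegral.integral_sub
      (hfc.circleIntegrable hρ0) ((hc1.mono hsub).circleIntegrable hρ0), h0, h1, sub_zero]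
  choose ρ hρ1 hρ2 hρ3 using hper
  have := sum_circleIntegral_of_holes c r ρ R (fun i => (hf.r_pos i).le) hρ1 hρ2 hf.disj
    Finset.univ (dslope k z) (-k z) hd hlim
  rw [Finset.sum_eq_zero fun i _ => hρ3 i] at this
  have hkz : k z = 0 := by simpa [Real.pi_ne_zero] using this.symm
  linear_combination hkz

end IsHoleMap

theorem IsPreconnected.exists_subset_of_subset_iUnion {X ι : Type*} [TopologicalSpace X]
    {S : Set X} (hS : IsPreconnected S) (hne : S.Nonempty) {U : ι → Set X}
    (hU : ∀ i, IsOpen (U i)) (hd : ∀ i j, i ≠ j → Disjoint (U i) (U j)) (hSU : S ⊆ ⋃ i, U i) :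
    ∃ i, S ⊆ U i := by
  obtain ⟨x, hx⟩ := hne
  obtain ⟨i, hi⟩ := mem_iUnion.1 (hSU hx)
  refine ⟨i, hS.subset_left_of_subset_union (hU i)
    (isOpen_biUnion fun j (_ : j ≠ i) => hU j) ?_ ?_ ⟨x, hx, hi⟩⟩
  · simp only [disjoint_iUnion_right]
    exact fun j hj => hd i j (Ne.symm hj)
  · intro y hy
    obtain ⟨j, hj⟩ := mem_iUnion.1 (hSU hy)
    by_cases h : j = i
    · exact .inl (h ▸ hj)
    · exact .inr (mem_biUnion h hj)

/-- Depth functions `d i` that vanish at the `i`-th end of the domain `Ω = {0 < d i}`. -/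
structure HasEnds {X ι : Type*} [TopologicalSpace X] (Ω : Set X) (d : ι → X → ℝ) (δ₀ : ℝ) :
    Prop where
  pos : 0 < δ₀
  mem_iff : ∀ x, x ∈ Ω ↔ ∀ i, 0 < d i x
  continuous : ∀ i, Continuous (d i)
  disj : ∀ i j, i ≠ j → ∀ x, d i x < δ₀ → δ₀ ≤ d j x
  isCompact : ∀ δ > 0, IsCompact {x | ∀ i, δ ≤ d i x}
  isPreconnected : ∀ i, ∀ δ, δ ≤ δ₀ → IsPreconnected {x | 0 < d i x ∧ d i x < δ}
  nonempty : ∀ i, ∀ δ > 0, δ ≤ δ₀ → {x | 0 < d i x ∧ d i x < δ}.Nonempty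

namespace HasEnds

variable {X ι : Type*} [TopologicalSpace X] {Ω : Set X} {d : ι → X → ℝ} {δ₀ : ℝ}

theorem mem_of_lt (hΩ : HasEnds Ω d δ₀) {i : ι} {x : X} (h0 : 0 < d i x) (h1 : d i x < δ₀) :
    x ∈ Ω := by
  refine (hΩ.mem_iff x).2 fun j => ?_
  by_cases h : i = j
  · exact h ▸ h0
  · exact hΩ.pos.trans_le (hΩ.disj i j h x h1)

theorem exists_end_image [Finite ι] (hΩ : HasEnds Ω d δ₀) {φ ψ : X → X} (hφ : ContinuousOn φ Ω)
    (hψ : ContinuousOn ψ Ω) (hψΩ : MapsTo ψ Ω Ω) (hinv : LeftInvOn ψ φ Ω)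
    (i : ι) : ∃ j, ∀ ε > 0, ∃ δ > 0, ∀ x ∈ Ω, d i x < δ → d j (φ x) < ε := by
  cases nonempty_fintype ι
  have key : ∀ ε > 0, ε ≤ δ₀ → ∃ j, ∃ δ > 0, δ ≤ δ₀ ∧
      ∀ x, 0 < d i x → d i x < δ → d j (φ x) < ε := by
    intro ε hε hεδ
    set K := {x | ∀ i, ε ≤ d i x} with hK
    have hKΩ : K ⊆ Ω := fun x hx => (hΩ.mem_iff x).2 fun i => hε.trans_le (hx i)
    have hK' : IsCompact (ψ '' K) := (hΩ.isCompact ε hε).image_of_continuousOn (hψ.mono hKΩ)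
    obtain ⟨δ, hδ, hδK⟩ : ∃ δ > 0, ∀ x ∈ ψ '' K, δ ≤ d i x := by
      rcases (ψ '' K).eq_empty_or_nonempty with h | h
      · exact ⟨1, one_pos, by simp [h]⟩
      · obtain ⟨x, hx, hmin⟩ := hK'.exists_isMinOn h (hΩ.continuous i).continuousOn
        obtain ⟨y, hy, rfl⟩ := hx
        exact ⟨_, (hΩ.mem_iff _).1 (hψΩ (hKΩ hy)) i, fun x hx => hmin hx⟩
    have hsub : {x | 0 < d i x ∧ d i x < min δ δ₀} ⊆ Ω := fun x hx =>
      hΩ.mem_of_lt hx.1 (hx.2.trans_le (min_le_right _ _))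
    have hm : 0 < min δ δ₀ := lt_min hδ hΩ.pos
    obtain ⟨j, hj⟩ := ((hΩ.isPreconnected i _ (min_le_right δ δ₀)).image φ
      (hφ.mono hsub)).exists_subset_of_subset_iUnion
      ((hΩ.nonempty i _ hm (min_le_right _ _)).image φ) (U := fun j => {x | d j x < ε})
      (fun j => isOpen_lt (hΩ.continuous j) continuous_const)
      (fun j k hjk => disjoint_left.2 fun x h1 h2 =>
        (hΩ.disj j k hjk x (lt_of_lt_of_le h1 hεδ)).not_gt (lt_of_lt_of_le h2 hεδ)) (by
        rintro _ ⟨x, hx, rfl⟩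
        by_contra hcon
        have hxK : φ x ∈ K := by simpa [hK] using hcon
        have := hδK _ (mem_image_of_mem ψ hxK)
        rw [hinv (hsub hx)] at this
        exact (hx.2.trans_le (min_le_left _ _)).not_ge this)
    exact ⟨j, _, hm, min_le_right _ _, fun x h1 h2 => hj (mem_image_of_mem φ ⟨h1, h2⟩)⟩
  obtain ⟨j, δ, hδ, hδ0, h⟩ := key δ₀ hΩ.pos le_rfl
  refine ⟨j, fun ε hε => ?_⟩
  obtain ⟨j', δ', hδ', hδ'0, h'⟩ := key (min ε δ₀) (lt_min hε hΩ.pos) (min_le_right _ _)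
  obtain ⟨x, hx0, hx1⟩ := hΩ.nonempty i (min δ δ') (lt_min hδ hδ') ((min_le_left _ _).trans hδ0)
  have hjj : j = j' := by
    by_contra hne
    refine (hΩ.disj j j' hne (φ x) (h x hx0 (hx1.trans_le (min_le_left _ _)))).not_gt ?_
    exact (h' x hx0 (hx1.trans_le (min_le_right _ _))).trans_le (min_le_right _ _)
  subst hjj
  exact ⟨δ', hδ', fun x hx hxδ =>
    (h' x ((hΩ.mem_iff x).1 hx i) hxδ).trans_le (min_le_left _ _)⟩

theorem exists_injective_end_map [Finite ι] (hΩ : HasEnds Ω d δ₀) {φ ψ : X → X}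
    (hφ : ContinuousOn φ Ω) (hψ : ContinuousOn ψ Ω) (hφΩ : MapsTo φ Ω Ω) (hψΩ : MapsTo ψ Ω Ω)
    (hinv : InvOn ψ φ Ω Ω) : ∃ σ : ι → ι, Function.Injective σ ∧
      ∀ i, ∀ ε > 0, ∃ δ > 0, ∀ x ∈ Ω, d i x < δ → d (σ i) (φ x) < ε := by
  choose σ hσ using hΩ.exists_end_image hφ hψ hψΩ hinv.1
  choose τ hτ using hΩ.exists_end_image hψ hφ hφΩ hinv.2
  refine ⟨σ, Function.LeftInverse.injective (g := τ) fun i => ?_, hσ⟩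
  by_contra hne
  obtain ⟨ε, hε, h1⟩ := hτ (σ i) δ₀ hΩ.pos
  obtain ⟨δ, hδ, h2⟩ := hσ i ε hε
  obtain ⟨x, hx0, hx1⟩ := hΩ.nonempty i (min δ δ₀) (lt_min hδ hΩ.pos) (min_le_right _ _)
  have hxΩ := hΩ.mem_of_lt hx0 (hx1.trans_le (min_le_right _ _))
  have h3 := h1 (φ x) (hφΩ hxΩ) (h2 x hxΩ (hx1.trans_le (min_le_left _ _)))
  rw [hinv.1 hxΩ] at h3
  exact (hΩ.disj _ i hne x h3).not_gt (hx1.trans_le (min_le_right _ _))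

end HasEnds

namespace RigidDomain

/-- Centres of the boundary circles. -/
noncomputable def center : Fin 4 → ℂ := ![0, 1 / 2, Complex.I / 2, -1 / 2]

/-- Radii of the boundary circles. -/
noncomputable def radius : Fin 4 → ℝ := ![1, 1 / 10, 1 / 20, 1 / 30]

/-- The side of the boundary circles on which the domain lies: `1` for outside, `-1` for inside. -/
noncomputable def side : Fin 4 → ℝ := ![-1, 1, 1, 1]

/-- The signed distance to the `k`-th boundary circle. -/
noncomputable def depth (k : Fin 4) (z : ℂ) : ℝ := side k * (‖z - center k‖ - radius k)

theorem side_mul_self (k : Fin 4) : side k * side k = 1 := by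
  fin_cases k <;> simp [side]

theorem radius_pos (k : Fin 4) : 0 < radius k := by
  fin_cases k <;> simp [radius]

theorem norm_sub_center (k : Fin 4) (z : ℂ) : ‖z - center k‖ = radius k + side k * depth k z := by
  rw [depth, ← mul_assoc, side_mul_self]; ring

theorem mem_iff (z : ℂ) : z ∈ RigidDomain ↔ ∀ k, 0 < depth k z := by
  simp [RigidDomain, depth, Fin.forall_fin_succ, side, center, radius, dist_eq_norm, and_assoc,
    neg_div]

theorem continuous_depth (k : Fin 4) : Continuous (depth k) := by
  unfold depth; fun_prop

theorem le_depth_add_depth {k l : Fin 4} (h : k ≠ l) (z : ℂ) : 1 / 5 ≤ depth k z + depth l z := by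
  wlog hkl : k < l generalizing k l
  · rw [add_comm]; exact this h.symm (lt_of_le_of_ne (not_lt.1 hkl) h.symm)
  have hre : ∀ u v : ℂ, |u.re - v.re| ≤ ‖z - u‖ + ‖z - v‖ := fun u v => by
    rw [← Complex.sub_re]
    refine (Complex.abs_re_le_norm _).trans ?_
    rw [norm_sub_rev, ← sub_sub_sub_cancel_left u v z]
    exact norm_sub_le _ _
  have him : ∀ u v : ℂ, |u.im - v.im| ≤ ‖z - u‖ + ‖z - v‖ := fun u v => by
    rw [← Complex.sub_im]
    refine (Complex.abs_im_le_norm _).trans ?_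
    rw [norm_sub_rev, ← sub_sub_sub_cancel_left u v z]
    exact norm_sub_le _ _
  have hz : ∀ v : ℂ, ‖z‖ ≤ ‖z - v‖ + ‖v‖ := fun v => norm_le_norm_sub_add z v
  have h1 := hz (1 / 2)
  have h2 := hz (Complex.I / 2)
  have h3 := hz (-1 / 2)
  have h12 := him (1 / 2) (Complex.I / 2)
  have h13 := hre (1 / 2) (-1 / 2)
  have h23 := him (Complex.I / 2) (-1 / 2)
  fin_cases k <;> fin_cases l <;> simp at hkl <;>
    simp [depth, side, center, radius] at h1 h2 h3 h12 h13 h23 ⊢ <;> norm_num at * <;> linarith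

theorem radius_add_pos (k : Fin 4) {t : ℝ} (h0 : 0 < t) (h1 : t < 1 / 10) :
    0 < radius k + side k * t := by
  fin_cases k <;> simp [side, radius] <;> linarith

theorem depth_circleMap (k : Fin 4) {t : ℝ} (h0 : 0 < t) (h1 : t < 1 / 10) (θ : ℝ) :
    depth k (circleMap (center k) (radius k + side k * t) θ) = t := by
  rw [depth, circleMap_sub_center, norm_circleMap_zero, abs_of_pos (radius_add_pos k h0 h1),
    add_sub_cancel_left, ← mul_assoc, side_mul_self, one_mul]

theorem hasEnds : HasEnds RigidDomain depth (1 / 10) where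
  pos := by norm_num
  mem_iff := mem_iff
  continuous := continuous_depth
  disj k l h z hz := by linarith [le_depth_add_depth h z]
  isCompact δ hδ := by
    refine (isCompact_closedBall (0 : ℂ) 1).of_isClosed_subset ?_ fun z hz => ?_
    · simp only [ofPred_forall]
      exact isClosed_iInter fun k => isClosed_le continuous_const (continuous_depth k)
    · have := hz 0
      simp [depth, side, center, radius] at this
      simp; linarith
  isPreconnected k δ hδ := by
    have : {z | 0 < depth k z ∧ depth k z < δ} =
        (fun p : ℝ × ℝ => circleMap (center k) (radius k + side k * p.1) p.2) ''
          (Ioo 0 δ ×ˢ univ) := by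
      ext z
      constructor
      · refine fun hz => ⟨(depth k z, (z - center k).arg), ⟨hz, mem_univ _⟩, ?_⟩
        simp only [circleMap, ← norm_sub_center, Complex.norm_mul_exp_arg_mul_I]
        ring
      · rintro ⟨⟨t, θ⟩, ⟨ht, -⟩, rfl⟩
        have := depth_circleMap k ht.1 (ht.2.trans_le hδ) θ
        exact ⟨this.symm ▸ ht.1, this.symm ▸ ht.2⟩
    rw [this]
    exact (isPreconnected_Ioo.prod isPreconnected_univ).image _
      (by unfold circleMap; fun_prop)
  nonempty k δ hδ hδ0 := by
    have := depth_circleMap k (t := δ / 2) (by linarith) (by linarith) 0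
    exact ⟨_, by rw [this]; linarith, by rw [this]; linarith⟩

/-- The power of the point `z` with respect to the `k`-th boundary circle. -/
noncomputable def power (k : Fin 4) (z : ℂ) : ℝ := ‖z - center k‖ ^ 2 - radius k ^ 2

/-- The centre of the image of the `k`-th boundary circle under `z ↦ (z - p)⁻¹`. -/
noncomputable def invCenter (p : ℂ) (k : Fin 4) : ℂ := conj (center k - p) / power k p

/-- The radius of the image of the `k`-th boundary circle under `z ↦ (z - p)⁻¹`. -/
noncomputable def invRadius (p : ℂ) (k : Fin 4) : ℝ := side k * radius k / power k p

/-- The inversive separation of two boundary circles, a Möbius invariant. -/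
noncomputable def separation (k l : Fin 4) : ℝ :=
  side k * side l * (‖center k - center l‖ ^ 2 - radius k ^ 2 - radius l ^ 2) /
    (radius k * radius l)

theorem side_mul_power (k : Fin 4) (z : ℂ) :
    side k * power k z = depth k z * (‖z - center k‖ + radius k) := by
  rw [power, depth]; ring

theorem depth_pos_iff (k : Fin 4) (z : ℂ) : 0 < depth k z ↔ 0 < side k * power k z := by
  have : 0 < ‖z - center k‖ + radius k := add_pos_of_nonneg_of_pos (norm_nonneg _) (radius_pos k)
  rw [side_mul_power, mul_pos_iff_of_pos_right this]

theorem side_mul_power_pos {z : ℂ} (hz : z ∈ RigidDomain) (k : Fin 4) : 0 < side k * power k z :=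
  (depth_pos_iff k z).1 ((mem_iff z).1 hz k)

theorem power_ne_zero {z : ℂ} (hz : z ∈ RigidDomain) (k : Fin 4) : power k z ≠ 0 :=
  right_ne_zero_of_mul (side_mul_power_pos hz k).ne'

theorem invRadius_eq {p : ℂ} (hp : p ∈ RigidDomain) (k : Fin 4) :
    invRadius p k = radius k / (side k * power k p) := by
  have h1 := power_ne_zero hp k
  have h2 : side k ≠ 0 := left_ne_zero_of_mul (side_mul_power_pos hp k).ne'
  rw [invRadius, div_eq_div_iff h1 (mul_ne_zero h2 h1)]
  linear_combination (radius k * power k p) * side_mul_self k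

theorem invRadius_pos {p : ℂ} (hp : p ∈ RigidDomain) (k : Fin 4) : 0 < invRadius p k := by
  rw [invRadius_eq hp]
  exact div_pos (radius_pos k) (side_mul_power_pos hp k)

theorem invRadius_sq (p : ℂ) (k : Fin 4) : invRadius p k ^ 2 = radius k ^ 2 / power k p ^ 2 := by
  rw [invRadius, div_pow, mul_pow, sq (side k), side_mul_self, one_mul]

theorem power_mul_norm_sub_invCenter {p z : ℂ} (hp : p ∈ RigidDomain) (hz : z ≠ p) (k : Fin 4) :
    power k p * (‖(z - p)⁻¹ - invCenter p k‖ ^ 2 - invRadius p k ^ 2) * ‖z - p‖ ^ 2 =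
      power k z := by
  have hN := power_ne_zero hp k
  have hu : z - p ≠ 0 := sub_ne_zero.2 hz
  have h1 : ‖(z - p)⁻¹ - invCenter p k‖ ^ 2 * ‖z - p‖ ^ 2 =
      ‖1 - (z - p) * conj (center k - p) * (power k p)⁻¹‖ ^ 2 := by
    rw [← mul_pow, ← norm_mul, sub_mul, inv_mul_cancel₀ hu, invCenter]
    congr 3
    push_cast
    ring
  have e1 : power k p = ‖center k - p‖ ^ 2 - radius k ^ 2 := by rw [power, norm_sub_rev]
  have e2 : power k z = ‖(z - p) - (center k - p)‖ ^ 2 - radius k ^ 2 := by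
    rw [power, sub_sub_sub_cancel_right]
  rw [invRadius_sq, mul_sub, sub_mul, mul_assoc, h1, e2]
  generalize power k p = N at *
  generalize z - p = u at *
  generalize center k - p = v at *
  clear h1 e2
  simp only [Complex.sq_norm, Complex.normSq_apply, Complex.sub_re, Complex.sub_im, Complex.mul_re,
    Complex.mul_im, Complex.conj_re, Complex.conj_im, Complex.ofReal_re, Complex.ofReal_im,
    Complex.one_re, Complex.one_im] at *
  field_simp
  linear_combination (N - u.re * u.re - u.im * u.im) * e1

theorem norm_sub_invCenter_sq {p : ℂ} (hp : p ∈ RigidDomain) (k l : Fin 4) :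
    ‖invCenter p k - invCenter p l‖ ^ 2 = invRadius p k ^ 2 + invRadius p l ^ 2 +
      separation k l * (invRadius p k * invRadius p l) := by
  have hN := power_ne_zero hp k
  have hN' := power_ne_zero hp l
  have e1 : power k p = ‖center k - p‖ ^ 2 - radius k ^ 2 := by rw [power, norm_sub_rev]
  have e1' : power l p = ‖center l - p‖ ^ 2 - radius l ^ 2 := by rw [power, norm_sub_rev]
  have h1 : separation k l * (invRadius p k * invRadius p l) =
      (‖(center k - p) - (center l - p)‖ ^ 2 - radius k ^ 2 - radius l ^ 2) /
        (power k p * power l p) := by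
    have := (radius_pos k).ne'
    have := (radius_pos l).ne'
    rw [separation, invRadius, invRadius, sub_sub_sub_cancel_right]
    field_simp
    rw [sq (side k), sq (side l), side_mul_self, side_mul_self]
    ring
  rw [h1, invRadius_sq, invRadius_sq, invCenter, invCenter, div_eq_mul_inv, div_eq_mul_inv (conj _)]
  generalize power k p = N at *
  generalize power l p = N' at *
  generalize center k - p = u at *
  generalize center l - p = v at *
  have e3 : ((N : ℂ)⁻¹) = ((N⁻¹ : ℝ) : ℂ) := by push_cast; rfl
  have e4 : ((N' : ℂ)⁻¹) = ((N'⁻¹ : ℝ) : ℂ) := by push_cast; rfl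
  rw [e3, e4]
  simp only [Complex.sq_norm, Complex.normSq_apply, Complex.sub_re, Complex.sub_im, Complex.mul_re,
    Complex.mul_im, Complex.conj_re, Complex.conj_im, Complex.ofReal_re, Complex.ofReal_im] at *
  field_simp
  linear_combination (N * N' - N' ^ 2) * e1 + (N * N' - N ^ 2) * e1'

theorem separation_eq (k l : Fin 4) : separation k l =
    !![-2, 38 / 5, 301 / 20, 338 / 15; 38 / 5, -2, 195 / 2, 890 / 3;
       301 / 20, 195 / 2, -2, 1787 / 6; 338 / 15, 890 / 3, 1787 / 6, -2] k l := by
  have : ‖center k - center l‖ ^ 2 =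
    !![0, 1 / 4, 1 / 4, 1 / 4; 1 / 4, 0, 1 / 2, 1; 1 / 4, 1 / 2, 0, 1 / 2;
       1 / 4, 1, 1 / 2, 0] k l := by
    rw [Complex.sq_norm, Complex.normSq_apply]
    fin_cases k <;> fin_cases l <;> simp [center] <;> norm_num
  rw [separation, this]
  fin_cases k <;> fin_cases l <;> simp [side, radius] <;> norm_num

theorem two_lt_separation {k l : Fin 4} (h : k ≠ l) : 2 < separation k l := by
  rw [separation_eq]
  fin_cases k <;> fin_cases l <;> simp at h ⊢ <;> norm_num

theorem eq_or_eq_of_separation_eq {k l k' l' : Fin 4} (h : k ≠ l) (h' : k' ≠ l')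
    (heq : separation k l = separation k' l') : k' = k ∨ k' = l := by
  rw [separation_eq, separation_eq] at heq
  fin_cases k <;> fin_cases l <;> simp at h <;> fin_cases k' <;> fin_cases l' <;>
    simp at h' heq ⊢ <;> norm_num at heq

theorem eq_self_of_separation_eq {σ : Fin 4 → Fin 4} (hσ : Function.Injective σ)
    (h : ∀ k l, k ≠ l → separation (σ k) (σ l) = separation k l) (k : Fin 4) : σ k = k := by
  obtain ⟨l, m, hl, hm, hlm⟩ : ∃ l m : Fin 4, k ≠ l ∧ k ≠ m ∧ l ≠ m := by
    revert k; decide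
  have h1 := eq_or_eq_of_separation_eq hl (hσ.ne hl) (h k l hl).symm
  have h2 := eq_or_eq_of_separation_eq hm (hσ.ne hm) (h k m hm).symm
  rcases h1 with h1 | h1
  · exact h1
  · exact h2.resolve_right fun h2 => hlm (h1.symm.trans h2)

theorem invRadius_add_lt {p : ℂ} (hp : p ∈ RigidDomain) {k l : Fin 4} (h : k ≠ l) :
    invRadius p k + invRadius p l < ‖invCenter p k - invCenter p l‖ := by
  have h1 := invRadius_pos hp k
  have h2 := invRadius_pos hp l
  refine lt_of_pow_lt_pow_left₀ 2 (norm_nonneg _) ?_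
  rw [norm_sub_invCenter_sq hp]
  nlinarith [mul_pos h1 h2, mul_pos (mul_pos h1 h2) (sub_pos.2 (two_lt_separation h))]

theorem zero_mem : (0 : ℂ) ∈ RigidDomain := by
  rw [mem_iff]
  intro k
  fin_cases k <;> simp [depth, side, center, radius] <;> norm_num

theorem isOpen : IsOpen RigidDomain := by
  have : RigidDomain = ⋂ k, {z | 0 < depth k z} := by ext z; simp [mem_iff]
  rw [this]
  exact isOpen_iInter_of_finite fun k => isOpen_lt continuous_const (continuous_depth k)

theorem norm_lt_one {z : ℂ} (hz : z ∈ RigidDomain) : ‖z‖ < 1 := by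
  simpa [RigidDomain] using hz.1

theorem side_mul_power_eq {p z : ℂ} (hp : p ∈ RigidDomain) (hz : z ≠ p) (k : Fin 4) :
    side k * power k p * (‖(z - p)⁻¹ - invCenter p k‖ ^ 2 - invRadius p k ^ 2) * ‖z - p‖ ^ 2 =
      side k * power k z := by
  rw [← power_mul_norm_sub_invCenter hp hz]; ring

theorem invRadius_lt {p z : ℂ} (hp : p ∈ RigidDomain) (hz : z ∈ RigidDomain) (hzp : z ≠ p)
    (k : Fin 4) : invRadius p k < ‖(z - p)⁻¹ - invCenter p k‖ := by
  have h := side_mul_power_pos hz k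
  rw [← side_mul_power_eq hp hzp] at h
  have h2 := pos_of_mul_pos_left h (sq_nonneg _)
  exact lt_of_pow_lt_pow_left₀ 2 (norm_nonneg _)
    (sub_pos.1 (pos_of_mul_pos_right h2 (side_mul_power_pos hp k).le))

theorem ne_zero_of_invRadius_lt {p w : ℂ} (hp : p ∈ RigidDomain)
    (hw : ∀ k, invRadius p k < ‖w - invCenter p k‖) : w ≠ 0 := by
  rintro rfl
  have h1 := hw 0
  rw [zero_sub, norm_neg] at h1
  have h2 := pow_lt_pow_left₀ h1 (invRadius_pos hp 0).le two_ne_zero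
  rw [invRadius_sq, invCenter, norm_div, div_pow, Complex.norm_conj, Complex.norm_real,
    norm_eq_abs, sq_abs, div_lt_div_iff_of_pos_right (sq_pos_of_ne_zero (power_ne_zero hp 0))] at h2
  have h3 := norm_lt_one hp
  simp [center, radius] at h2
  nlinarith [norm_nonneg p]

theorem add_inv_mem {p w : ℂ} (hp : p ∈ RigidDomain)
    (hw : ∀ k, invRadius p k < ‖w - invCenter p k‖) : p + w⁻¹ ∈ RigidDomain := by
  have hw0 := ne_zero_of_invRadius_lt hp hw
  refine (mem_iff _).2 fun k => (depth_pos_iff k _).2 ?_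
  have hne : p + w⁻¹ ≠ p := by simpa using hw0
  rw [← side_mul_power_eq hp hne, add_sub_cancel_left, inv_inv]
  have h1 := pow_lt_pow_left₀ (hw k) (invRadius_pos hp k).le two_ne_zero
  have h2 : 0 < ‖w⁻¹‖ := norm_pos_iff.2 (inv_ne_zero hw0)
  exact mul_pos (mul_pos (side_mul_power_pos hp k) (sub_pos.2 h1)) (by positivity)

theorem depth_sub_depth_le (k : Fin 4) (z p : ℂ) : depth k p - depth k z ≤ ‖z - p‖ := by
  have h1 := norm_sub_norm_le (z - center k) (p - center k)
  have h2 := norm_sub_norm_le (p - center k) (z - center k)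
  rw [sub_sub_sub_cancel_right] at h1 h2
  rw [norm_sub_rev p z] at h2
  have : side k = 1 ∨ side k = -1 := by
    have := side_mul_self k
    exact mul_self_eq_one_iff.1 this
  rcases this with h | h <;> rw [depth, depth, h] <;> linarith

theorem norm_sub_center_add_radius_le {z : ℂ} (hz : z ∈ RigidDomain) (k : Fin 4) :
    ‖z - center k‖ + radius k ≤ 4 := by
  have h1 := norm_sub_le z (center k)
  have h2 := norm_lt_one hz
  have h3 : ‖center k‖ + radius k ≤ 3 := by
    fin_cases k <;> simp [center, radius] <;> norm_num
  linarith

theorem exists_depth_lt_imp {p : ℂ} (hp : p ∈ RigidDomain) (k : Fin 4) {s : ℝ}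
    (hs : invRadius p k < s) : ∃ ε > 0, ∀ z ∈ RigidDomain, depth k z < ε →
      ‖(z - p)⁻¹ - invCenter p k‖ < s := by
  have hm : 0 < depth k p / 2 := half_pos ((mem_iff p).1 hp k)
  have hN := side_mul_power_pos hp k
  have hr := invRadius_pos hp k
  have hs2 : 0 < s ^ 2 - invRadius p k ^ 2 := sub_pos.2 (pow_lt_pow_left₀ hs hr.le two_ne_zero)
  refine ⟨min (depth k p / 2)
    (side k * power k p * (s ^ 2 - invRadius p k ^ 2) * (depth k p / 2) ^ 2 / 4),
    lt_min hm (by positivity), fun z hz hlt => ?_⟩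
  obtain ⟨h1, h2⟩ := lt_min_iff.1 hlt
  have hzp : depth k p / 2 ≤ ‖z - p‖ := by linarith [depth_sub_depth_le k z p]
  have hne : z ≠ p := by rintro rfl; simp at hzp; linarith
  have h3 := side_mul_power_eq hp hne k
  rw [side_mul_power k z] at h3
  have h4 : depth k z * (‖z - center k‖ + radius k) ≤ depth k z * 4 :=
    mul_le_mul_of_nonneg_left (norm_sub_center_add_radius_le hz k) ((mem_iff z).1 hz k).le
  refine lt_of_pow_lt_pow_left₀ 2 (hr.trans hs).le ?_
  by_contra! hcon
  have h5 : side k * power k p * (s ^ 2 - invRadius p k ^ 2) * (depth k p / 2) ^ 2 ≤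
      side k * power k p * (‖(z - p)⁻¹ - invCenter p k‖ ^ 2 - invRadius p k ^ 2) *
        ‖z - p‖ ^ 2 := by
    gcongr
    exact mul_nonneg hN.le (by linarith)
  linarith

theorem exists_norm_lt_imp {p : ℂ} (hp : p ∈ RigidDomain) (k : Fin 4) {ε : ℝ} (hε : 0 < ε) :
    ∃ t > invRadius p k, ∀ z ∈ RigidDomain, z ≠ p → ‖(z - p)⁻¹ - invCenter p k‖ < t →
      depth k z < ε := by
  have hN := side_mul_power_pos hp k
  have hρ := radius_pos k
  have hr := invRadius_pos hp k
  have hq : 0 < ε * radius k / (4 * (side k * power k p)) := by positivity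
  refine ⟨√(invRadius p k ^ 2 + ε * radius k / (4 * (side k * power k p))),
    lt_sqrt_of_sq_lt (by linarith), fun z hz hne hlt => ?_⟩
  rw [lt_sqrt (norm_nonneg _), ← sub_lt_iff_lt_add', lt_div_iff₀ (by positivity)] at hlt
  have h3 := side_mul_power_eq hp hne k
  rw [side_mul_power k z] at h3
  have h4 : ‖z - p‖ ^ 2 ≤ 2 ^ 2 := by
    gcongr
    linarith [norm_sub_le z p, norm_lt_one hz, norm_lt_one hp]
  have hz0 := (mem_iff z).1 hz k
  have h5 : depth k z * radius k ≤ depth k z * (‖z - center k‖ + radius k) := by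
    gcongr; linarith [norm_nonneg (z - center k)]
  have h6 := pow_lt_pow_left₀ (invRadius_lt hp hz hne k) hr.le two_ne_zero
  have h7 : side k * power k p * (‖(z - p)⁻¹ - invCenter p k‖ ^ 2 - invRadius p k ^ 2) *
      ‖z - p‖ ^ 2 ≤ side k * power k p *
      (‖(z - p)⁻¹ - invCenter p k‖ ^ 2 - invRadius p k ^ 2) * 2 ^ 2 :=
    mul_le_mul_of_nonneg_left h4 (mul_pos hN (sub_pos.2 h6)).le
  exact lt_of_mul_lt_mul_right (by linarith) hρ.le

theorem power_zero (k : Fin 4) : power k 0 = ![-1, 6 / 25, 99 / 400, 56 / 225] k := by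
  fin_cases k <;> simp [power, center, radius] <;> norm_num

theorem invCenter_zero (k : Fin 4) :
    invCenter 0 k = ![0, 25 / 12, -(200 / 99 * Complex.I), -(225 / 112)] k := by
  rw [invCenter, power_zero]
  have h2 : conj (2 : ℂ) = 2 := Complex.conj_ofNat 2
  fin_cases k <;> simp [center, h2] <;> ring

theorem invRadius_zero (k : Fin 4) : invRadius 0 k = ![1, 5 / 12, 20 / 99, 15 / 112] k := by
  rw [invRadius, power_zero]
  fin_cases k <;> simp [side, radius] <;> norm_num

theorem two_le_norm_invCenter_zero_sub {k l : Fin 4} (h : k ≠ l) :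
    2 ≤ ‖invCenter 0 k - invCenter 0 l‖ := by
  wlog hkl : k < l generalizing k l
  · rw [norm_sub_rev]; exact this h.symm (lt_of_le_of_ne (not_lt.1 hkl) h.symm)
  have h1 := Complex.abs_re_le_norm (invCenter 0 k - invCenter 0 l)
  have h2 := Complex.abs_im_le_norm (invCenter 0 k - invCenter 0 l)
  rw [Complex.sub_re, invCenter_zero, invCenter_zero] at h1
  rw [Complex.sub_im, invCenter_zero, invCenter_zero] at h2
  rw [invCenter_zero, invCenter_zero]
  fin_cases k <;> fin_cases l <;> simp at hkl <;>
    simp at h1 h2 ⊢ <;> norm_num at * <;> linarith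

/-- Radii of pairwise disjoint discs around the inverted holes. -/
noncomputable def collarRadius : Fin 4 → ℝ := ![101 / 100, 43 / 100, 22 / 100, 15 / 100]

/-- Contraction factors of the reflections in the inverted holes. -/
noncomputable def contraction : Fin 4 → ℝ := ![41 / 100, 20 / 100, 5 / 100, 2 / 100]

theorem invRadius_zero_lt_collarRadius (k : Fin 4) : invRadius 0 k < collarRadius k := by
  rw [invRadius_zero]
  fin_cases k <;> simp [collarRadius] <;> norm_num

theorem contraction_nonneg (k : Fin 4) : 0 ≤ contraction k := by
  fin_cases k <;> simp [contraction] <;> norm_num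

theorem sum_contraction_lt_one : ∑ k, contraction k < 1 := by
  simp [Fin.sum_univ_four, contraction]; norm_num

theorem disjoint_collars {k l : Fin 4} (h : k ≠ l) :
    Disjoint (ball (invCenter 0 k) (collarRadius k)) (ball (invCenter 0 l) (collarRadius l)) := by
  refine ball_disjoint_ball (le_trans ?_ ((two_le_norm_invCenter_zero_sub h).trans_eq
    (dist_eq_norm _ _).symm))
  fin_cases k <;> fin_cases l <;> simp [collarRadius] at h ⊢ <;> norm_num

theorem invRadius_zero_sq_le {k l : Fin 4} (h : k ≠ l) {z : ℂ}
    (hz : z ∈ ball (invCenter 0 k) (collarRadius k)) :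
    invRadius 0 l ^ 2 ≤ contraction l * ‖z - invCenter 0 l‖ ^ 2 := by
  have h1 := two_le_norm_invCenter_zero_sub h
  rw [mem_ball_iff_norm] at hz
  have h2 : 2 - collarRadius k ≤ ‖z - invCenter 0 l‖ := by
    have := norm_sub_le_norm_sub_add_norm_sub (invCenter 0 k) z (invCenter 0 l)
    rw [norm_sub_rev _ z] at this
    linarith
  have h3 : 0 ≤ 2 - collarRadius k := by
    fin_cases k <;> simp [collarRadius] <;> norm_num
  refine le_trans ?_ (mul_le_mul_of_nonneg_left (pow_le_pow_left₀ h3 h2 2) (contraction_nonneg l))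
  rw [invRadius_zero]
  fin_cases k <;> fin_cases l <;> simp [collarRadius, contraction] at h ⊢ <;> norm_num

end RigidDomain

theorem not_eventually_eq_of_injOn {φ : ℂ → ℂ} {U : Set ℂ} (hU : IsOpen U) (hinj : InjOn φ U)
    {z : ℂ} (hz : z ∈ U) : ¬∀ᶠ x in 𝓝 z, φ x = φ z := by
  intro h
  have h1 : ∀ᶠ x in 𝓝 z, x = z := by
    filter_upwards [h, hU.mem_nhds hz] with x hx hxU using hinj hxU hz hx
  have h2 : ∀ᶠ x in 𝓝[≠] z, x ≠ z := self_mem_nhdsWithin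
  obtain ⟨x, hx1, hx2⟩ := (h2.and (h1.filter_mono nhdsWithin_le_nhds)).exists
  exact hx1 hx2

theorem nhds_le_map_of_injOn {φ : ℂ → ℂ} {U : Set ℂ} (hU : IsOpen U)
    (hφ : DifferentiableOn ℂ φ U) (hinj : InjOn φ U) {z : ℂ} (hz : z ∈ U) :
    𝓝 (φ z) ≤ map φ (𝓝 z) :=
  ((hφ.analyticAt (hU.mem_nhds hz)).eventually_constant_or_nhds_le_map_nhds).resolve_left
    (not_eventually_eq_of_injOn hU hinj hz)

theorem continuousAt_of_leftInvOn {φ ψ : ℂ → ℂ} {U : Set ℂ} (hU : IsOpen U)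
    (hφ : DifferentiableOn ℂ φ U) (hψ : LeftInvOn ψ φ U) {z : ℂ} (hz : z ∈ U) :
    ContinuousAt ψ (φ z) := by
  intro N hN
  rw [hψ hz] at hN
  refine nhds_le_map_of_injOn hU hφ hψ.injOn hz ?_
  rw [Filter.mem_map]
  filter_upwards [hN, hU.mem_nhds hz] with x hx hxU
  simpa [hψ hxU] using hx

theorem deriv_ne_zero_of_injOn {φ : ℂ → ℂ} {U : Set ℂ} (hU : IsOpen U)
    (hφ : DifferentiableOn ℂ φ U) (hinj : InjOn φ U) {z : ℂ} (hz : z ∈ U) : deriv φ z ≠ 0 := by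
  have hψ : LeftInvOn (Function.invFunOn φ U) φ U := hinj.leftInvOn_invFunOn
  set ψ := Function.invFunOn φ U
  have hright : ∀ᶠ w in 𝓝 (φ z), w ∈ φ '' U :=
    nhds_le_map_of_injOn hU hφ hinj hz (mem_map.2 (mem_of_superset (hU.mem_nhds hz)
      (subset_preimage_image φ U)))
  have hcont := continuousAt_of_leftInvOn hU hφ hψ hz
  have han : AnalyticAt ℂ (deriv φ) z := (hφ.analyticAt (hU.mem_nhds hz)).deriv
  have hd : ∀ x ∈ U, DifferentiableAt ℂ φ x := fun x hx => hφ.differentiableAt (hU.mem_nhds hx)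
  have hne : ∀ᶠ x in 𝓝[≠] z, deriv φ x ≠ 0 := by
    refine han.eventually_eq_zero_or_eventually_ne_zero.resolve_left fun h => ?_
    refine not_eventually_eq_of_injOn hU hinj hz ?_
    obtain ⟨δ, hδ, hball⟩ := Metric.mem_nhds_iff.1 (inter_mem (hU.mem_nhds hz) h)
    filter_upwards [ball_mem_nhds z hδ] with x hx
    exact (convex_ball z δ).is_const_of_fderivWithin_eq_zero (𝕜 := ℂ)
      (hφ.mono fun y hy => (hball hy).1) (fun y hy => by
        rw [fderivWithin_of_isOpen isOpen_ball hy]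
        ext
        simpa using (hball hy).2) hx (mem_ball_self hδ)
  have hψz : ψ (φ z) = z := hψ hz
  have hdψ : DifferentiableAt ℂ ψ (φ z) := by
    refine (Complex.analyticAt_of_differentiable_on_punctured_nhds_of_continuousAt ?_
      hcont).differentiableAt
    have hlim : Tendsto ψ (𝓝[≠] (φ z)) (𝓝[≠] z) := by
      refine tendsto_nhdsWithin_iff.2 ⟨?_, ?_⟩
      · have := hcont.tendsto.mono_left (nhdsWithin_le_nhds (s := {φ z}ᶜ))
        rwa [hψz] at this
      · filter_upwards [hright.filter_mono nhdsWithin_le_nhds, self_mem_nhdsWithin] with w hw hwz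
        obtain ⟨x, hx, rfl⟩ := hw
        rw [hψ hx]
        rintro rfl
        exact hwz rfl
    filter_upwards [hlim.eventually hne, hright.filter_mono nhdsWithin_le_nhds,
      (eventually_eventually_nhds.2 hright).filter_mono nhdsWithin_le_nhds] with w h1 h2 h3
    obtain ⟨x, hx, rfl⟩ := h2
    refine (HasDerivAt.of_local_left_inverse (f := φ) (f' := deriv φ (ψ (φ x)))
      (continuousAt_of_leftInvOn hU hφ hψ hx) ?_ h1 ?_).differentiableAt
    · rw [hψ hx]
      exact (hd x hx).hasDerivAt
    · filter_upwards [h3] with y hy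
      obtain ⟨v, hv, rfl⟩ := hy
      rw [hψ hv]
  have hcomp : HasDerivAt (ψ ∘ φ) (deriv ψ (φ z) * deriv φ z) z :=
    hdψ.hasDerivAt.comp z (hd z hz).hasDerivAt
  have hid : HasDerivAt (ψ ∘ φ) 1 z := by
    refine (hasDerivAt_id z).congr_of_eventuallyEq ?_
    filter_upwards [hU.mem_nhds hz] with x hx using hψ hx
  exact right_ne_zero_of_mul (a := deriv ψ (φ z)) (by rw [hcomp.unique hid]; exact one_ne_zero)

theorem exists_tendsto_inv_sub {φ : ℂ → ℂ} {U : Set ℂ} (hU : U ∈ 𝓝 (0 : ℂ))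
    (hφ : DifferentiableOn ℂ φ U) (h0 : deriv φ 0 ≠ 0) :
    ∃ b, Tendsto (fun w => (φ w⁻¹ - φ 0)⁻¹ - (deriv φ 0)⁻¹ * w) (Bornology.cobounded ℂ) (𝓝 b) := by
  have hq : DifferentiableAt ℂ (dslope φ 0) 0 :=
    ((Complex.differentiableOn_dslope hU).2 hφ).differentiableAt hU
  have hq0 : dslope φ 0 0 ≠ 0 := by rwa [dslope_same]
  have hlim := (hasDerivAt_iff_tendsto_slope.1 (hq.inv hq0).hasDerivAt).comp
    (tendsto_inv₀_cobounded' (α := ℂ))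
  refine ⟨_, hlim.congr' ?_⟩
  filter_upwards [Bornology.eventually_ne_cobounded (0 : ℂ)] with w hw
  have hw' : w⁻¹ ≠ 0 := inv_ne_zero hw
  simp only [Function.comp_apply, slope_def_field, Pi.inv_apply, dslope_same, dslope_of_ne _ hw',
    sub_zero]
  rw [sub_div, inv_div, div_div, mul_comm (φ _ - _)]
  field_simp

theorem IsHoleMap.center_eq_and_radius_eq {ι : Type*} {c c' : ι → ℂ} {r r' R R' : ι → ℝ}
    {f : ℂ → ℂ} (hf : IsHoleMap c c' r r' R R' f) {a b : ℂ} (ha : a ≠ 0)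
    (hfa : ∀ z, (∀ i, r i < ‖z - c i‖) → f z = a * z + b) (i : ι) :
    c' i = a * c i + b ∧ r' i = ‖a‖ * r i := by
  have hri := hf.r_pos i
  have hcirc : ∀ u : ℂ, ‖u‖ = 1 → ‖(a * c i + b - c' i) + r i * (a * u)‖ = r' i := by
    intro u hu
    have hlim : Tendsto (fun t : ℝ => ‖(a * c i + b - c' i) + t * (a * u)‖) (𝓝[>] (r i))
        (𝓝 ‖(a * c i + b - c' i) + r i * (a * u)‖) :=
      Continuous.tendsto' (by fun_prop) _ _ rfl |>.mono_left nhdsWithin_le_nhds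
    have hmem : ∀ t > r i, ‖(c i + t * u) - c i‖ = t := fun t ht => by
      rw [add_sub_cancel_left, norm_mul, hu, mul_one, Complex.norm_real, norm_eq_abs,
        abs_of_pos (hri.trans ht)]
    have hval : ∀ t > r i, t < R i →
        f (c i + t * u) - c' i = (a * c i + b - c' i) + t * (a * u) := fun t h1 h2 => by
      rw [hfa _ (hf.mem_of_mem_collar (by rwa [hmem t h1]) (by rwa [hmem t h1]))]
      ring
    refine le_antisymm (le_of_forall_gt_imp_ge_of_dense fun s hs => ?_) ?_
    · obtain ⟨t₀, ht₀, h⟩ := hf.bdry i s hs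
      refine le_of_tendsto hlim ?_
      filter_upwards [Ioo_mem_nhdsGT (lt_min ht₀ (hf.r_lt i))] with t ht
      obtain ⟨h1, h2⟩ := lt_min_iff.1 ht.2
      rw [← hval t ht.1 h2]
      exact (h _ (by rw [hmem t ht.1]; exact ht.1) (by rwa [hmem t ht.1])).le
    · refine ge_of_tendsto hlim ?_
      filter_upwards [Ioo_mem_nhdsGT (hf.r_lt i)] with t ht
      rw [← hval t ht.1 ht.2]
      exact (hf.mapsTo _ (hf.mem_of_mem_collar (by rw [hmem t ht.1]; exact ht.1)
        (by rw [hmem t ht.1]; exact ht.2)) i).le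
  have hd : a * c i + b - c' i = 0 := by
    have hsq : ∀ u : ℂ, ‖u‖ = 1 → ‖(a * c i + b - c' i) + r i * (a * u)‖ ^ 2 = r' i ^ 2 :=
      fun u hu => by rw [hcirc u hu]
    have h1 := hsq 1 (by simp)
    have h2 := hsq (-1) (by simp)
    have h3 := hsq Complex.I (by simp)
    have h4 := hsq (-Complex.I) (by simp)
    generalize a * c i + b - c' i = d at *
    have ha2 : 0 < a.re ^ 2 + a.im ^ 2 := by
      have := Complex.normSq_pos.2 ha
      rw [Complex.normSq_apply] at this
      linarith
    simp [Complex.sq_norm, Complex.normSq_apply] at h1 h2 h3 h4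
    have e1 : d.re * a.re + d.im * a.im = 0 := by
      have : r i * (d.re * a.re + d.im * a.im) = 0 := by linarith
      exact (mul_eq_zero.1 this).resolve_left hri.ne'
    have e2 : d.im * a.re - d.re * a.im = 0 := by
      have : r i * (d.im * a.re - d.re * a.im) = 0 := by linarith
      exact (mul_eq_zero.1 this).resolve_left hri.ne'
    have e3 : (a.re ^ 2 + a.im ^ 2) * d.re = 0 := by linear_combination a.re * e1 - a.im * e2
    have e4 : (a.re ^ 2 + a.im ^ 2) * d.im = 0 := by linear_combination a.im * e1 + a.re * e2
    exact Complex.ext ((mul_eq_zero.1 e3).resolve_left ha2.ne')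
      ((mul_eq_zero.1 e4).resolve_left ha2.ne')
  refine ⟨(sub_eq_zero.1 hd).symm, ?_⟩
  have := hcirc 1 (by simp)
  rw [hd, zero_add, mul_one, norm_mul, Complex.norm_real, norm_eq_abs, abs_of_pos hri] at this
  rw [← this, mul_comm]

namespace RigidDomain

theorem exists_pos_invRadius_add_le {p : ℂ} (hp : p ∈ RigidDomain) :
    ∃ ε > 0, ∀ k l, k ≠ l →
      invRadius p k + (invRadius p l + ε) ≤ ‖invCenter p k - invCenter p l‖ := by
  have h : ∀ᶠ ε : ℝ in 𝓝[>] 0, ∀ k l, k ≠ l →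
      invRadius p k + (invRadius p l + ε) ≤ ‖invCenter p k - invCenter p l‖ := by
    refine eventually_all.2 fun k => eventually_all.2 fun l => ?_
    by_cases hkl : k = l
    · exact .of_forall fun _ h => absurd hkl h
    · filter_upwards [Ioo_mem_nhdsGT (sub_pos.2 (invRadius_add_lt hp hkl))] with ε hε _
      linarith [hε.2]
  have h0 : ∀ᶠ ε : ℝ in 𝓝[>] 0, 0 < ε := self_mem_nhdsWithin
  exact (h0.and h).exists

theorem isHoleMap_inv {φ : ℂ → ℂ} (hφ : DifferentiableOn ℂ φ RigidDomain)
    (hmap : MapsTo φ RigidDomain RigidDomain) (hinj : InjOn φ RigidDomain) {σ : Fin 4 → Fin 4}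
    (hσ : Function.Injective σ)
    (hend : ∀ i, ∀ ε > 0, ∃ δ > 0, ∀ x ∈ RigidDomain, depth i x < δ → depth (σ i) (φ x) < ε) :
    ∃ R', IsHoleMap (invCenter 0) (invCenter (φ 0) ∘ σ) (invRadius 0) (invRadius (φ 0) ∘ σ)
      collarRadius R' fun w => (φ w⁻¹ - φ 0)⁻¹ := by
  have hb : φ 0 ∈ RigidDomain := hmap zero_mem
  obtain ⟨ε, hε, hsep⟩ := exists_pos_invRadius_add_le hb
  have hmem : ∀ w, (∀ k, invRadius 0 k < ‖w - invCenter 0 k‖) →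
      w ≠ 0 ∧ w⁻¹ ∈ RigidDomain ∧ φ w⁻¹ ≠ φ 0 := fun w hw => by
    have h1 := ne_zero_of_invRadius_lt zero_mem hw
    have h2 := add_inv_mem zero_mem hw
    rw [zero_add] at h2
    exact ⟨h1, h2, fun h => inv_ne_zero h1 (hinj h2 zero_mem h)⟩
  refine ⟨fun i => invRadius (φ 0) (σ i) + ε, invRadius_pos zero_mem,
    invRadius_zero_lt_collarRadius, fun i j => disjoint_collars, fun i => invRadius_pos hb _,
    fun i => lt_add_of_pos_right _ hε, fun i j hij w hw => ?_, fun w hw => ?_, fun w hw i => ?_,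
    fun i s hs => ?_⟩
  · rw [mem_ball_iff_norm] at hw
    have h1 := hsep _ _ (hσ.ne hij)
    have h2 := norm_sub_le_norm_sub_add_norm_sub (invCenter (φ 0) (σ i)) w (invCenter (φ 0) (σ j))
    rw [norm_sub_rev _ w] at h2
    simp only [Function.comp_apply] at hw ⊢
    linarith
  · obtain ⟨h1, h2, h3⟩ := hmem w hw
    have h4 : DifferentiableAt ℂ φ w⁻¹ := hφ.differentiableAt (isOpen.mem_nhds h2)
    exact ((h4.comp w (differentiableAt_inv h1)).sub_const _).inv (sub_ne_zero.2 h3)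
  · obtain ⟨h1, h2, h3⟩ := hmem w hw
    exact invRadius_lt hb (hmap h2) h3 (σ i)
  · obtain ⟨ε', hε', h⟩ := exists_depth_lt_imp hb (σ i) hs
    obtain ⟨δ, hδ, h'⟩ := hend i ε' hε'
    obtain ⟨t, ht, h''⟩ := exists_norm_lt_imp zero_mem i hδ
    refine ⟨min t (collarRadius i), lt_min ht (invRadius_zero_lt_collarRadius i),
      fun w h1 h2 => ?_⟩
    obtain ⟨h2, h3⟩ := lt_min_iff.1 h2
    have hw : ∀ k, invRadius 0 k < ‖w - invCenter 0 k‖ := fun k => by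
      by_cases hik : i = k
      · exact hik ▸ h1
      · have hz := (disjoint_collars hik).notMem_of_mem_left (mem_ball_iff_norm.2 h3)
        rw [mem_ball_iff_norm, not_lt] at hz
        exact (invRadius_zero_lt_collarRadius k).trans_le hz
    obtain ⟨k1, k2, k3⟩ := hmem w hw
    exact h _ (hmap k2) (h' _ k2 (h'' _ k2 (inv_ne_zero k1) (by rwa [sub_zero, inv_inv])))

theorem eq_zero_of_invRadius_ratio {p : ℂ} (hp : p ∈ RigidDomain) {m : ℝ}
    (h : ∀ k, invRadius p k = m * invRadius 0 k) : p = 0 := by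
  have hk : ∀ k, radius k * side k = m * invRadius 0 k * power k p := fun k => by
    have := power_ne_zero hp k
    rw [← h k, invRadius]
    field_simp
  have h0 := hk 0
  have h1 := hk 1
  have h3 := hk 3
  simp only [invRadius_zero, power, Complex.sq_norm, Complex.normSq_apply] at h0 h1 h3
  simp [radius, side, center] at h0 h1 h3
  have hm : m ≠ 0 := by rintro rfl; simp at h0
  have e1 : m * (p.re * p.re + p.im * p.im) = 0 := by linarith
  have e2 := (mul_eq_zero.1 e1).resolve_left hm
  exact Complex.ext (by simpa using (by nlinarith : p.re = 0))
    (by simpa using (by nlinarith : p.im = 0))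

end RigidDomain

/-- The domain `D(0,1) \ (cl(D(1/2,1/10)) ∪ cl(D(i/2,1/20)) ∪ cl(D(-1/2,1/30)))`
is rigid: its only automorphism is the identity. -/
theorem rigid_domain_only_identity_automorphism (φ : ℂ → ℂ)
    (hhol : DifferentiableOn ℂ φ RigidDomain)
    (hbij : Set.BijOn φ RigidDomain RigidDomain) :
    ∀ z ∈ RigidDomain, φ z = z := by
  have hinv := hbij.invOn_invFunOn
  set ψ := Function.invFunOn φ RigidDomain
  have hψmap : MapsTo ψ RigidDomain RigidDomain := hbij.surjOn.mapsTo_invFunOn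
  have hψ : ContinuousOn ψ RigidDomain := fun w hw => by
    obtain ⟨z, hz, rfl⟩ := hbij.surjOn hw
    exact (continuousAt_of_leftInvOn RigidDomain.isOpen hhol hinv.1 hz).continuousWithinAt
  obtain ⟨σ, hσ, hend⟩ := RigidDomain.hasEnds.exists_injective_end_map hhol.continuousOn hψ
    hbij.mapsTo hψmap hinv
  obtain ⟨R', hf⟩ := RigidDomain.isHoleMap_inv hhol hbij.mapsTo hbij.injOn hσ hend
  have hb : φ 0 ∈ RigidDomain := hbij.mapsTo RigidDomain.zero_mem
  have ha := deriv_ne_zero_of_injOn RigidDomain.isOpen hhol hbij.injOn RigidDomain.zero_mem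
  obtain ⟨β, hβ⟩ := exists_tendsto_inv_sub (RigidDomain.isOpen.mem_nhds RigidDomain.zero_mem)
    hhol ha
  have ha' := inv_ne_zero ha
  generalize (deriv φ 0)⁻¹ = a at hβ ha'
  have haff := fun z hz => hf.eq_affine RigidDomain.contraction_nonneg
    (fun i j hij z hz => RigidDomain.invRadius_zero_sq_le hij hz)
    RigidDomain.sum_contraction_lt_one hβ (z := z) hz
  have hcr := hf.center_eq_and_radius_eq ha' haff
  simp only [Function.comp_apply] at hcr
  have hσ_eq : ∀ k, σ k = k := RigidDomain.eq_self_of_separation_eq hσ fun k l _ => by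
    have h1 := RigidDomain.norm_sub_invCenter_sq hb (σ k) (σ l)
    have h2 := RigidDomain.norm_sub_invCenter_sq RigidDomain.zero_mem k l
    rw [(hcr k).1, (hcr l).1, (hcr k).2, (hcr l).2, add_sub_add_right_eq_sub, ← mul_sub, norm_mul,
      mul_pow, h2] at h1
    have h3 : ‖a‖ ^ 2 * (RigidDomain.invRadius 0 k * RigidDomain.invRadius 0 l) ≠ 0 := by
      have := RigidDomain.invRadius_pos RigidDomain.zero_mem k
      have := RigidDomain.invRadius_pos RigidDomain.zero_mem l
      have := norm_pos_iff.2 ha'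
      positivity
    refine mul_right_cancel₀ h3 ?_
    linear_combination -h1
  simp only [hσ_eq] at hcr
  have hφ0 : φ 0 = 0 := RigidDomain.eq_zero_of_invRadius_ratio hb fun k => (hcr k).2
  have h0 := (hcr 0).1
  have h1 := (hcr 1).1
  rw [hφ0] at h0 h1
  simp only [RigidDomain.invCenter_zero] at h0 h1
  have hβ0 : β = 0 := by simpa using h0.symm
  have ha1 : a = 1 := by simpa [hβ0] using h1
  intro z hz
  by_cases hz0 : z = 0
  · rw [hz0, hφ0]
  · have h2 := haff z⁻¹ fun k => by
      simpa using RigidDomain.invRadius_lt RigidDomain.zero_mem hz hz0 k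
    simpa [hφ0, ha1, hβ0] using h2
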